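/- arXiv:math/0502226 — 9 statements merged into one kernel-verified Lean document; each statement's English description precedes it below -/
import Mathlib

section
/- Let (X, d_X) and (Y, d_Y) be two compact real trees such that the Gromov–Hausdorff distance satisfies d_GH((X,d_X),(Y,d_Y)) < ε for some ε > 0. Then there exists a Borel measurable 3ε-isometry from X to Y. -/
open MeasureTheory Metric Set

/-- The four point condition for a distance function. -/
def FourPoint {X : Type*} (d : X → X → ℝ) : Prop :=
  ∀ x₁ x₂ x₃ x₄ : X, d x₁ x₂ + d x₃ x₄ ≤ max (d x₁ x₃ + d x₂ x₄) (d x₁ x₄ + d x₂ x₃)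

/-- A real tree: a metric space which is complete, path-connected and satisfies
the four point condition. -/
def IsRealTree (X : Type*) [MetricSpace X] : Prop :=
  CompleteSpace X ∧ PathConnectedSpace X ∧ FourPoint (fun x y : X => dist x y)

/-- `dis(f) ≤ ε`: the distortion of `f` is at most `ε`. -/
def DistortionLE {X Y : Type*} [MetricSpace X] [MetricSpace Y] (f : X → Y) (ε : ℝ) : Prop :=
  ∀ x₁ x₂ : X, |dist x₁ x₂ - dist (f x₁) (f x₂)| ≤ ε

/-- `f` is an `ε`-isometry: it has distortion at most `ε` and its range is an `ε`-net. -/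
def IsEpsIsometry {X Y : Type*} [MetricSpace X] [MetricSpace Y] (f : X → Y) (ε : ℝ) : Prop :=
  DistortionLE f ε ∧ ∀ y : Y, ∃ x : X, dist y (f x) ≤ ε

/-- If two compact real trees are at Gromov–Hausdorff distance less than `ε`, then there is
a Borel measurable `3ε`-isometry from one to the other. -/
theorem exists_measurable_three_eps_isometry
    (X : Type*) (Y : Type*) [MetricSpace X] [CompactSpace X] [Nonempty X]
    [MeasurableSpace X] [BorelSpace X]
    [MetricSpace Y] [CompactSpace Y] [Nonempty Y]
    [MeasurableSpace Y] [BorelSpace Y]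
    (hX : IsRealTree X) (hY : IsRealTree Y)
    (ε : ℝ) (hε : 0 < ε) (h : GromovHausdorff.ghDist X Y < ε) :
    ∃ f : X → Y, Measurable f ∧ IsEpsIsometry f (3 * ε) := by
  classical
  obtain ⟨Φ, Ψ, hΦ, hΨ, hH⟩ := GromovHausdorff.ghDist_eq_hausdorffDist X Y
  rw [hH] at h
  have fin : hausdorffEDist (range Φ) (range Ψ) ≠ ⊤ :=
    hausdorffEDist_ne_top_of_nonempty_of_bounded (range_nonempty Φ) (range_nonempty Ψ)
      (isCompact_range hΦ.continuous).isBounded (isCompact_range hΨ.continuous).isBounded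
  have key : ∀ x : X, ∃ n : ℕ, dist (Φ x) (Ψ (TopologicalSpace.denseSeq Y n)) < ε := by
    intro x
    obtain ⟨z, ⟨y, rfl⟩, hz⟩ := exists_dist_lt_of_hausdorffDist_lt (mem_range_self x) h fin
    have ho : IsOpen {y : Y | dist (Φ x) (Ψ y) < ε} :=
      isOpen_lt (continuous_const.dist hΨ.continuous) continuous_const
    obtain ⟨w, hw, n, rfl⟩ :=
      (TopologicalSpace.denseRange_denseSeq Y).inter_open_nonempty _ ho ⟨y, hz⟩
    exact ⟨n, hw⟩
  have hf : ∀ x : X, dist (Φ x) (Ψ (TopologicalSpace.denseSeq Y (Nat.find (key x)))) < ε :=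
    fun x => Nat.find_spec (key x)
  refine ⟨fun x => TopologicalSpace.denseSeq Y (Nat.find (key x)), ?_, ?_, ?_⟩
  · refine (measurable_from_top (f := TopologicalSpace.denseSeq Y)).comp
      (measurable_find key fun n => ?_)
    exact (isOpen_lt (hΦ.continuous.dist continuous_const) continuous_const).measurableSet
  · intro x₁ x₂
    have h1 := hf x₁
    have h2 := hf x₂
    rw [← hΦ.dist_eq x₁ x₂, ← hΨ.dist_eq]
    have h3 := dist_dist_dist_le (Φ x₁) (Φ x₂)
      (Ψ (TopologicalSpace.denseSeq Y (Nat.find (key x₁))))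
      (Ψ (TopologicalSpace.denseSeq Y (Nat.find (key x₂))))
    rw [Real.dist_eq] at h3
    linarith
  · intro y
    obtain ⟨z, ⟨x, rfl⟩, hz⟩ := exists_dist_lt_of_hausdorffDist_lt' (mem_range_self y) h fin
    refine ⟨x, ?_⟩
    have h1 := hf x
    rw [← hΨ.dist_eq]
    have := dist_triangle_left (Ψ y) (Ψ (TopologicalSpace.denseSeq Y (Nat.find (key x)))) (Φ x)
    linarith
end

section
/- For any three weighted compact real trees X = (X, d_X, ν_X), Y = (Y, d_Y, ν_Y) and Z = (Z, d_Z, ν_Z), one has the doubled triangle inequality Δ_GHwt(X, Z) ≤ 2[Δ_GHwt(X, Y) + Δ_GHwt(Y, Z)]. -/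
open MeasureTheory Metric Set

/-- The Prohorov distance between two Borel measures. -/
noncomputable def prohorovDist {X : Type*} [MetricSpace X] [MeasurableSpace X]
    (μ ν : Measure X) : ℝ :=
  sInf {ε : ℝ | 0 < ε ∧ ∀ C : Set X, IsClosed C →
    μ C ≤ ν (Metric.thickening ε C) + ENNReal.ofReal ε}

/-- `Δ_GHwt` between two weighted metric spaces: the infimum of all `ε > 0` such that there
exist Borel measurable `ε`-isometries `f : X → Y` and `g : Y → X` with
`d_P(f_*ν_X, ν_Y) ≤ ε` and `d_P(ν_X, g_*ν_Y) ≤ ε`. -/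
noncomputable def DeltaGHwt (X Y : Type*) [MetricSpace X] [MeasurableSpace X]
    [MetricSpace Y] [MeasurableSpace Y] (νX : Measure X) (νY : Measure Y) : ℝ :=
  sInf {ε : ℝ | 0 < ε ∧
    (∃ f : X → Y, Measurable f ∧ IsEpsIsometry f ε ∧ prohorovDist (νX.map f) νY ≤ ε) ∧
    (∃ g : Y → X, Measurable g ∧ IsEpsIsometry g ε ∧ prohorovDist νX (νY.map g) ≤ ε)}


/-- Above the Prohorov distance, the defining inequality holds for every set. -/
lemma prohorov_bound {X : Type*} [MetricSpace X] [MeasurableSpace X]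
    (μ ν : Measure X) [IsProbabilityMeasure μ] {δ : ℝ} (h : prohorovDist μ ν < δ) (A : Set X) :
    μ A ≤ ν (Metric.thickening δ A) + ENNReal.ofReal δ := by
  have hne : {ε : ℝ | 0 < ε ∧ ∀ C : Set X, IsClosed C →
      μ C ≤ ν (Metric.thickening ε C) + ENNReal.ofReal ε}.Nonempty := by
    refine ⟨1, one_pos, fun C _ => ?_⟩
    refine prob_le_one.trans ?_
    simp
  obtain ⟨e, ⟨_, he⟩, hlt⟩ := exists_lt_of_csInf_lt hne h
  calc μ A ≤ μ (closure A) := measure_mono subset_closure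
    _ ≤ ν (Metric.thickening e (closure A)) + ENNReal.ofReal e := he _ isClosed_closure
    _ ≤ _ := by
      rw [Metric.thickening_closure]
      exact add_le_add (measure_mono (Metric.thickening_mono hlt.le A))
        (ENNReal.ofReal_le_ofReal hlt.le)

lemma prohorov_le {X : Type*} [MetricSpace X] [MeasurableSpace X]
    (μ ν : Measure X) {ε : ℝ} (h0 : 0 < ε) (h : ∀ C : Set X, IsClosed C →
      μ C ≤ ν (Metric.thickening ε C) + ENNReal.ofReal ε) : prohorovDist μ ν ≤ ε :=
  csInf_le ⟨0, fun _ hx => hx.1.le⟩ ⟨h0, h⟩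

lemma prohorov_le_one {X : Type*} [MetricSpace X] [MeasurableSpace X]
    (μ ν : Measure X) [IsProbabilityMeasure μ] : prohorovDist μ ν ≤ 1 :=
  prohorov_le μ ν one_pos fun C _ => prob_le_one.trans (by simp)

lemma epsIsometry_comp {X Y Z : Type*} [MetricSpace X] [MetricSpace Y] [MetricSpace Z]
    {f : X → Y} {g : Y → Z} {a b : ℝ} (ha : 0 < a)
    (hf : IsEpsIsometry f a) (hg : IsEpsIsometry g b) :
    IsEpsIsometry (g ∘ f) (2 * (a + b)) := by
  refine ⟨fun x₁ x₂ => ?_, fun z => ?_⟩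
  · have hb : 0 ≤ b := (abs_nonneg _).trans (hg.1 (f x₁) (f x₂))
    have h1 := abs_le.1 (hf.1 x₁ x₂)
    have h2 := abs_le.1 (hg.1 (f x₁) (f x₂))
    simp only [Function.comp]
    rw [abs_le]
    constructor <;> linarith
  · obtain ⟨y, hy⟩ := hg.2 z
    obtain ⟨x, hx⟩ := hf.2 y
    refine ⟨x, ?_⟩
    have h2 := abs_le.1 (hg.1 y (f x))
    have := dist_triangle z (g y) (g (f x))
    simp only [Function.comp]
    linarith

lemma image_thickening {X Y : Type*} [MetricSpace X] [MetricSpace Y]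
    {g : X → Y} {b δ : ℝ} (hg : DistortionLE g b) (C : Set Y) :
    Metric.thickening δ (g ⁻¹' C) ⊆ g ⁻¹' (Metric.thickening (b + δ) C) := by
  intro x hx
  obtain ⟨a, ha, hd⟩ := Metric.mem_thickening_iff.1 hx
  refine Metric.mem_thickening_iff.2 ⟨g a, ha, ?_⟩
  have := abs_le.1 (hg x a)
  linarith

lemma deltaGHwt_set_nonempty (X Y : Type*) [MetricSpace X] [CompactSpace X] [Nonempty X]
    [MeasurableSpace X] [BorelSpace X]
    [MetricSpace Y] [CompactSpace Y] [Nonempty Y] [MeasurableSpace Y] [BorelSpace Y]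
    (νX : Measure X) (νY : Measure Y) [IsProbabilityMeasure νX] [IsProbabilityMeasure νY] :
    {ε : ℝ | 0 < ε ∧
    (∃ f : X → Y, Measurable f ∧ IsEpsIsometry f ε ∧ prohorovDist (νX.map f) νY ≤ ε) ∧
    (∃ g : Y → X, Measurable g ∧ IsEpsIsometry g ε ∧ prohorovDist νX (νY.map g) ≤ ε)}.Nonempty := by
  obtain ⟨x0⟩ := ‹Nonempty X›
  obtain ⟨y0⟩ := ‹Nonempty Y›
  have hx : 0 ≤ diam (univ : Set X) := diam_nonneg
  have hy : 0 ≤ diam (univ : Set Y) := diam_nonneg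
  have bx : ∀ a b : X, dist a b ≤ diam (univ : Set X) := fun a b =>
    dist_le_diam_of_mem isCompact_univ.isBounded (mem_univ _) (mem_univ _)
  have bY : ∀ a b : Y, dist a b ≤ diam (univ : Set Y) := fun a b =>
    dist_le_diam_of_mem isCompact_univ.isBounded (mem_univ _) (mem_univ _)
  have hm : Measurable (fun _ : X => y0) := measurable_const
  haveI := Measure.isProbabilityMeasure_map (μ := νX) hm.aemeasurable
  refine ⟨diam (univ : Set X) + diam (univ : Set Y) + 1, by positivity,
    ⟨fun _ => y0, hm, ⟨fun a b => ?_, fun y => ⟨x0, ?_⟩⟩, ?_⟩,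
    ⟨fun _ => x0, measurable_const, ⟨fun a b => ?_, fun y => ⟨y0, ?_⟩⟩, ?_⟩⟩
  · rw [dist_self, sub_zero, abs_of_nonneg dist_nonneg]
    linarith [bx a b]
  · linarith [bY y y0]
  · linarith [prohorov_le_one (νX.map fun _ => y0) νY]
  · rw [dist_self, sub_zero, abs_of_nonneg dist_nonneg]
    linarith [bY a b]
  · linarith [bx y x0]
  · linarith [prohorov_le_one νX (νY.map fun _ => x0)]

lemma ennreal_chain {u v w : ENNReal} {p q r : ℝ} (hp : 0 ≤ p) (hq : 0 ≤ q) (hr : p + q ≤ r)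
    (h1 : u ≤ v + ENNReal.ofReal p) (h2 : v ≤ w + ENNReal.ofReal q) :
    u ≤ w + ENNReal.ofReal r := by
  calc u ≤ v + ENNReal.ofReal p := h1
    _ ≤ w + ENNReal.ofReal q + ENNReal.ofReal p := by gcongr
    _ = w + ENNReal.ofReal (p + q) := by
      rw [add_assoc, ← ENNReal.ofReal_add hq hp, add_comm q p]
    _ ≤ _ := by gcongr

/-- Composition of the witnesses for `Δ_GHwt`. -/
lemma deltaGHwt_le_of_witness (X Y Z : Type*) [MetricSpace X]
    [MeasurableSpace X] [BorelSpace X]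
    [MetricSpace Y] [MeasurableSpace Y] [BorelSpace Y]
    [MetricSpace Z] [MeasurableSpace Z] [BorelSpace Z]
    (νX : Measure X) (νY : Measure Y) (νZ : Measure Z)
    [IsProbabilityMeasure νX] [IsProbabilityMeasure νY] [IsProbabilityMeasure νZ]
    {a b : ℝ} (ha : 0 < a) (hb : 0 < b)
    {f₁ : X → Y} (mf₁ : Measurable f₁) (hf₁ : IsEpsIsometry f₁ a)
    (pf₁ : prohorovDist (νX.map f₁) νY ≤ a)
    {g₁ : Y → X} (mg₁ : Measurable g₁) (hg₁ : IsEpsIsometry g₁ a)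
    (pg₁ : prohorovDist νX (νY.map g₁) ≤ a)
    {f₂ : Y → Z} (mf₂ : Measurable f₂) (hf₂ : IsEpsIsometry f₂ b)
    (pf₂ : prohorovDist (νY.map f₂) νZ ≤ b)
    {g₂ : Z → Y} (mg₂ : Measurable g₂) (hg₂ : IsEpsIsometry g₂ b)
    (pg₂ : prohorovDist νY (νZ.map g₂) ≤ b) :
    DeltaGHwt X Z νX νZ ≤ 2 * (a + b) := by
  have hab : 0 < 2 * (a + b) := by positivity
  refine csInf_le ⟨0, fun _ hx => hx.1.le⟩ ⟨hab,
    ⟨f₂ ∘ f₁, mf₂.comp mf₁, epsIsometry_comp ha hf₁ hf₂, prohorov_le _ _ hab fun C hC => ?_⟩,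
    ⟨g₁ ∘ g₂, mg₁.comp mg₂, ?_, prohorov_le _ _ hab fun C hC => ?_⟩⟩
  · haveI := Measure.isProbabilityMeasure_map (μ := νX) mf₁.aemeasurable
    haveI := Measure.isProbabilityMeasure_map (μ := νY) mf₂.aemeasurable
    have h1 := prohorov_bound (νX.map f₁) νY (δ := a + a / 2) (by linarith) (f₂ ⁻¹' C)
    have h2 := prohorov_bound (νY.map f₂) νZ (δ := b + a / 2) (by linarith)
      (Metric.thickening (b + (a + a / 2)) C)
    rw [Measure.map_apply mf₂ Metric.isOpen_thickening.measurableSet] at h2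
    rw [← Measure.map_map mf₂ mf₁, Measure.map_apply mf₂ hC.measurableSet]
    refine ennreal_chain (p := a + a / 2) (q := b + a / 2) (by positivity) (by positivity)
      (by linarith) h1 (((measure_mono (image_thickening hf₂.1 C)).trans h2).trans ?_)
    gcongr
    refine (Metric.thickening_thickening_subset _ _ _).trans (Metric.thickening_mono ?_ _)
    linarith
  · have := epsIsometry_comp hb hg₂ hg₁
    rwa [add_comm b a] at this
  · have h1 := prohorov_bound νX (νY.map g₁) (δ := a + b / 2) (by linarith) C
    have h2 := prohorov_bound νY (νZ.map g₂) (δ := b + b / 2) (by linarith)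
      (g₁ ⁻¹' (Metric.thickening (a + b / 2) C))
    rw [Measure.map_apply mg₁ Metric.isOpen_thickening.measurableSet] at h1
    rw [Measure.map_apply mg₂ Metric.isOpen_thickening.measurableSet] at h2
    rw [Measure.map_apply (mg₁.comp mg₂) Metric.isOpen_thickening.measurableSet]
    refine ennreal_chain (p := a + b / 2) (q := b + b / 2) (by positivity) (by positivity)
      (by linarith) h1 (h2.trans ?_)
    gcongr
    rw [preimage_comp]
    refine preimage_mono ((image_thickening hg₁.1 _).trans (preimage_mono ?_))
    refine (Metric.thickening_thickening_subset _ _ _).trans (Metric.thickening_mono ?_ _)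
    linarith

/-- The doubled triangle inequality for `Δ_GHwt` on weighted compact real trees:
`Δ_GHwt(X,Z) ≤ 2 [Δ_GHwt(X,Y) + Δ_GHwt(Y,Z)]`. -/
theorem deltaGHwt_doubled_triangle
    (X Y Z : Type*) [MetricSpace X] [CompactSpace X] [Nonempty X]
    [MeasurableSpace X] [BorelSpace X]
    [MetricSpace Y] [CompactSpace Y] [Nonempty Y]
    [MeasurableSpace Y] [BorelSpace Y]
    [MetricSpace Z] [CompactSpace Z] [Nonempty Z]
    [MeasurableSpace Z] [BorelSpace Z]
    (hX : IsRealTree X) (hY : IsRealTree Y) (hZ : IsRealTree Z)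
    (νX : Measure X) (νY : Measure Y) (νZ : Measure Z)
    [IsProbabilityMeasure νX] [IsProbabilityMeasure νY] [IsProbabilityMeasure νZ] :
    DeltaGHwt X Z νX νZ ≤ 2 * (DeltaGHwt X Y νX νY + DeltaGHwt Y Z νY νZ) := by
  refine le_of_forall_pos_le_add fun η hη => ?_
  obtain ⟨a, ⟨ha, ⟨f₁, mf₁, hf₁, pf₁⟩, ⟨g₁, mg₁, hg₁, pg₁⟩⟩, hal⟩ :=
    exists_lt_of_csInf_lt (deltaGHwt_set_nonempty X Y νX νY)
      (show DeltaGHwt X Y νX νY < DeltaGHwt X Y νX νY + η / 4 by linarith)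
  obtain ⟨b, ⟨hb, ⟨f₂, mf₂, hf₂, pf₂⟩, ⟨g₂, mg₂, hg₂, pg₂⟩⟩, hbl⟩ :=
    exists_lt_of_csInf_lt (deltaGHwt_set_nonempty Y Z νY νZ)
      (show DeltaGHwt Y Z νY νZ < DeltaGHwt Y Z νY νZ + η / 4 by linarith)
  have := deltaGHwt_le_of_witness X Y Z νX νY νZ ha hb mf₁ hf₁ pf₁ mg₁ hg₁ pg₁
    mf₂ hf₂ pf₂ mg₂ hg₂ pg₂
  linarith
end

section
/- Let S be a set and Δ : S × S → [0,∞) a symmetric function with Δ(x,x) = 0 for all x ∈ S, satisfying Δ(x,z) ≤ 2[Δ(x,y) + Δ(y,z)] for all x,y,z ∈ S. Define d(x,y) := inf{Σ_{i=1}^{n−1} Δ(z_i, z_{i+1})^{1/4}}, where the infimum is over all finite sequences z₁, …, z_n in S with z₁ = x and z_n = y. Then (1/2)·Δ(x,y)^{1/4} ≤ d(x,y) ≤ Δ(x,y)^{1/4} for all x,y ∈ S; in particular, for every finite chain z₁,…,z_n in S one has Δ(z₁,z_n)^{1/4} ≤ 2·Σ_{i=1}^{n−1} Δ(z_i, z_{i+1})^{1/4}.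 -/
open Finset

/-- The set of sums `Σ_{i=1}^{n-1} Δ(z_i, z_{i+1})^{1/4}` over all finite chains
`z₁ = x, …, z_n = y`. -/
def chainSums {S : Type*} (Δ : S → S → ℝ) (x y : S) : Set ℝ :=
  {r | ∃ (n : ℕ) (z : Fin (n + 1) → S), z 0 = x ∧ z (Fin.last n) = y ∧
    r = ∑ i : Fin n, (Δ (z i.castSucc) (z i.succ)) ^ ((1 : ℝ) / 4)}

/-- `d(x,y) := inf { Σ Δ(z_i, z_{i+1})^{1/4} }` over all finite chains from `x` to `y`. -/
noncomputable def chainDist {S : Type*} (Δ : S → S → ℝ) (x y : S) : ℝ :=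
  sInf (chainSums Δ x y)

/-- For a nonnegative symmetric function `Δ` vanishing on the diagonal and satisfying the
doubled triangle inequality `Δ(x,z) ≤ 2[Δ(x,y) + Δ(y,z)]`, the chain distance
`d(x,y) = inf Σ Δ(z_i,z_{i+1})^{1/4}` satisfies
`(1/2) Δ(x,y)^{1/4} ≤ d(x,y) ≤ Δ(x,y)^{1/4}`; in particular every finite chain satisfies
`Δ(z₁,z_n)^{1/4} ≤ 2 Σ Δ(z_i,z_{i+1})^{1/4}`. -/
theorem chainDist_bounds {S : Type*} (Δ : S → S → ℝ)
    (hnonneg : ∀ x y : S, 0 ≤ Δ x y)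
    (hsymm : ∀ x y : S, Δ x y = Δ y x)
    (hdiag : ∀ x : S, Δ x x = 0)
    (htri : ∀ x y z : S, Δ x z ≤ 2 * (Δ x y + Δ y z)) :
    (∀ x y : S,
      (1 / 2) * (Δ x y) ^ ((1 : ℝ) / 4) ≤ chainDist Δ x y ∧
        chainDist Δ x y ≤ (Δ x y) ^ ((1 : ℝ) / 4)) ∧
    (∀ (n : ℕ) (z : Fin (n + 1) → S),
      (Δ (z 0) (z (Fin.last n))) ^ ((1 : ℝ) / 4) ≤
        2 * ∑ i : Fin n, (Δ (z i.castSucc) (z i.succ)) ^ ((1 : ℝ) / 4)) := by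
  have chain : ∀ (n : ℕ) (z : Fin (n + 1) → S),
      (Δ (z 0) (z (Fin.last n))) ^ ((1 : ℝ) / 4) ≤
        2 * ∑ i : Fin n, (Δ (z i.castSucc) (z i.succ)) ^ ((1 : ℝ) / 4) := by
    have h0 : ∀ x y, 0 ≤ (Δ x y) ^ ((1 : ℝ) / 4) := fun x y => Real.rpow_nonneg (hnonneg x y) _
    have h4 : ∀ x y, ((Δ x y) ^ ((1 : ℝ) / 4)) ^ 4 = Δ x y := by
      intro x y
      rw [← Real.rpow_natCast, ← Real.rpow_mul (hnonneg x y)]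
      norm_num
    let d : S → S → NNReal := fun x y => ⟨(Δ x y) ^ ((1 : ℝ) / 4), h0 x y⟩
    have hdc : ∀ x y, ((d x y : NNReal) : ℝ) = (Δ x y) ^ ((1 : ℝ) / 4) := fun x y => rfl
    have ds : ∀ x, d x x = 0 := by
      intro x
      apply NNReal.coe_injective
      rw [hdc, hdiag]
      norm_num
    have dc : ∀ x y, d x y = d y x := by
      intro x y
      apply NNReal.coe_injective
      rw [hdc, hdc, hsymm]
    have hd : ∀ x₁ x₂ x₃ x₄, d x₁ x₄ ≤ 2 * max (d x₁ x₂) (max (d x₂ x₃) (d x₃ x₄)) := by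
      intro a b c e
      obtain ⟨m, hm⟩ : ∃ m, m = max (d a b) (max (d b c) (d c e)) := ⟨_, rfl⟩
      rw [← hm]
      have key : ∀ x y, d x y ≤ m → Δ x y ≤ (m : ℝ) ^ 4 := by
        intro x y h
        rw [← h4 x y]
        exact pow_le_pow_left₀ (h0 x y) (NNReal.coe_le_coe.2 h) 4
      have k1 := key a b (by rw [hm]; exact le_max_left _ _)
      have k2 := key b c (by rw [hm]; exact (le_max_left _ _).trans (le_max_right _ _))
      have k3 := key c e (by rw [hm]; exact (le_max_right _ _).trans (le_max_right _ _))
      have t1 := htri a b e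
      have t2 := htri b c e
      rw [← NNReal.coe_le_coe]
      push_cast
      refine le_of_pow_le_pow_left₀ (n := 4) (by norm_num) (by positivity) ?_
      rw [hdc, h4, mul_pow]
      have : (0 : ℝ) ≤ (m : ℝ) ^ 4 := by positivity
      linarith
    intro n z
    letI : PseudoMetricSpace S := PseudoMetricSpace.ofPreNNDist d ds dc
    have lower : (Δ (z 0) (z (Fin.last n))) ^ ((1 : ℝ) / 4) ≤ 2 * dist (z 0) (z (Fin.last n)) :=
      PseudoMetricSpace.le_two_mul_dist_ofPreNNDist d ds dc hd _ _
    have upper : ∀ x y : S, dist x y ≤ (Δ x y) ^ ((1 : ℝ) / 4) := fun x y =>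
      PseudoMetricSpace.dist_ofPreNNDist_le d ds dc x y
    have tri : ∀ (n : ℕ) (z : Fin (n + 1) → S), dist (z 0) (z (Fin.last n)) ≤
        ∑ i : Fin n, (Δ (z i.castSucc) (z i.succ)) ^ ((1 : ℝ) / 4) := by
      intro n
      induction n with
      | zero => intro z; simp
      | succ k ih =>
        intro z
        rw [Fin.sum_univ_castSucc]
        have h1 := ih (fun i => z i.castSucc)
        have h2 := upper (z (Fin.last k).castSucc) (z (Fin.last (k + 1)))
        have h3 := dist_triangle (z 0) (z (Fin.last k).castSucc) (z (Fin.last (k + 1)))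
        exact h3.trans (add_le_add h1 h2)
    linarith [tri n z]
  refine ⟨fun x y => ?_, chain⟩
  have mem : (Δ x y) ^ ((1 : ℝ) / 4) ∈ chainSums Δ x y :=
    ⟨1, ![x, y], rfl, rfl, by simp⟩
  have lb : ∀ r ∈ chainSums Δ x y, (1 / 2) * (Δ x y) ^ ((1 : ℝ) / 4) ≤ r := by
    rintro r ⟨n, z, rfl, rfl, rfl⟩
    linarith [chain n z]
  exact ⟨le_csInf ⟨_, mem⟩ lb, csInf_le ⟨_, lb⟩ mem⟩
end

section
/- A subset E of the space (T, d_GH) of isometry classes of compact real trees with the Gromov–Hausdorff metric is relatively compact if and only if for all ε > 0, sup{μ^T(R_ε(T)) : T ∈ E} < ∞, where μ^T is the length measure of T and R_ε(T) is the ε-trimming of T. -/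
open Metric Set

/-- The (closed) arc `[a,b]` in a real tree: the set of points lying between `a` and `b`. -/
def arcSet {X : Type*} [MetricSpace X] (a b : X) : Set X :=
  {x | dist a x + dist x b = dist a b}

/-- The open arc `]a,b[`. -/
def openArc {X : Type*} [MetricSpace X] (a b : X) : Set X :=
  arcSet a b \ {a, b}

/-- The skeleton `T° = ⋃_{a,b} ]a,b[` of a real tree. -/
def skeleton (X : Type*) [MetricSpace X] : Set X :=
  ⋃ (a : X) (b : X), openArc a b

/-- The length measure on a (compact real) tree: the trace of the one-dimensional
Hausdorff measure on the skeleton. -/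
noncomputable def lengthMeasure (X : Type*) [MetricSpace X] :
    @MeasureTheory.Measure X (borel X) :=
  letI : MeasurableSpace X := borel X
  haveI : BorelSpace X := ⟨rfl⟩
  MeasureTheory.Measure.restrict (MeasureTheory.Measure.hausdorffMeasure 1) (skeleton X)

/-- The `ε`-trimming of `T` relative to the root `ρ`:
`R_ε(T,ρ) = {x : ∃ y, x ∈ [ρ,y], d(x,y) ≥ ε} ∪ {ρ}`. -/
def trimmedAt (X : Type*) [MetricSpace X] (ε : ℝ) (ρ : X) : Set X :=
  {x | ∃ y : X, x ∈ arcSet ρ y ∧ ε ≤ dist x y} ∪ {ρ}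

open Classical in
/-- The `ε`-trimming `R_ε(T) = ⋂_ρ R_ε(T,ρ)` if `diam T > ε`, and a single point
otherwise. -/
noncomputable def trimmed (X : Type*) [MetricSpace X] [Nonempty X] (ε : ℝ) : Set X :=
  if ε < Metric.diam (Set.univ : Set X) then ⋂ ρ : X, trimmedAt X ε ρ
  else {Classical.arbitrary X}

/-- `(T, d_GH)`: the space of isometry classes of compact real trees, realized as the
subspace of the Gromov–Hausdorff space consisting of classes of real trees, with the
Gromov–Hausdorff metric. -/
abbrev TreeSpace : Type := {p : GromovHausdorff.GHSpace // IsRealTree p.Rep}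

section Helpers

open MeasureTheory GromovHausdorff Filter Topology

/-- All intermediate points on geodesics exist. -/
def HasPts (X : Type*) [MetricSpace X] : Prop :=
  ∀ (a b : X) (t : ℝ), 0 ≤ t → t ≤ dist a b → ∃ x : X, dist a x = t ∧ dist x b = dist a b - t

lemma hasPts_of_tree {X : Type*} [MetricSpace X] (h : IsRealTree X) : HasPts X := by
  obtain ⟨-, hp, h4⟩ := h
  intro a b t ht0 htd
  by_contra hno
  push Not at hno
  have hta : t ≠ 0 := by
    rintro rfl
    exact hno a (by simp) (by simp)
  have ht0' : 0 < t := lt_of_le_of_ne ht0 (Ne.symm hta)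
  have hcl : IsClopen {x : X | dist a x - dist x b < 2 * t - dist a b} := by
    constructor
    · rw [← isOpen_compl_iff, Metric.isOpen_iff]
      intro x hx
      simp only [mem_compl_iff, mem_ofPred_eq, not_lt] at hx
      rcases lt_or_eq_of_le hx with hlt | heq
      · refine ⟨((dist a x - dist x b) - (2 * t - dist a b)) / 2, by linarith, ?_⟩
        intro y hy
        simp only [mem_compl_iff, mem_ofPred_eq, not_lt]
        rw [mem_ball] at hy
        have h1 := dist_triangle a y x
        have h2 := dist_triangle y x b
        linarith
      · have hpos : 0 < dist a x - t := by
          by_contra hle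
          have h1 := dist_triangle a x b
          have e1 : dist a x = t := by linarith
          exact hno x e1 (by linarith)
        refine ⟨dist a x - t, hpos, ?_⟩
        intro y hy
        simp only [mem_compl_iff, mem_ofPred_eq, not_lt]
        rw [mem_ball] at hy
        by_contra hlt
        push Not at hlt
        have h5 := h4 a x y b
        simp only at h5
        have h1 := dist_triangle a y b
        have := dist_comm x y
        rcases le_max_iff.1 h5 with h6 | h6 <;> linarith
    · exact isOpen_lt (by fun_prop) (by fun_prop)
  rcases isClopen_iff.1 hcl with h0 | h1
  · have : a ∈ {x : X | dist a x - dist x b < 2 * t - dist a b} := by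
      simp only [mem_ofPred_eq, dist_self]; linarith
    rw [h0] at this
    exact this
  · have : b ∈ {x : X | dist a x - dist x b < 2 * t - dist a b} := by
      rw [h1]; trivial
    simp only [mem_ofPred_eq, dist_self] at this
    linarith

lemma arc_dist {X : Type*} [MetricSpace X] (h4 : FourPoint (fun x y : X => dist x y))
    {a b x y : X} (hx : x ∈ arcSet a b) (hy : y ∈ arcSet a b) :
    dist x y ≤ |dist a x - dist a y| := by
  simp only [arcSet, mem_ofPred_eq] at hx hy
  have h := h4 a b x y
  simp only at h
  have h1 := dist_comm b y
  have h2 := dist_comm b x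
  have := le_abs_self (dist a x - dist a y)
  have := neg_abs_le (dist a x - dist a y)
  rcases le_max_iff.1 h with h | h <;> linarith

lemma arc_split {X : Type*} [MetricSpace X] (h4 : FourPoint (fun x y : X => dist x y))
    {a b z : X} (ρ : X) (hz : z ∈ arcSet a b) : z ∈ arcSet ρ a ∨ z ∈ arcSet ρ b := by
  simp only [arcSet, mem_ofPred_eq] at hz ⊢
  have h := h4 z ρ a b
  simp only at h
  have h1 := dist_comm z ρ
  have h2 := dist_comm z a
  have h3 := dist_triangle ρ z a
  have h4 := dist_triangle ρ z b
  rcases le_max_iff.1 h with h | h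
  · right; linarith
  · left; linarith

lemma tree_of_hasPts {X : Type*} [MetricSpace X] [CompactSpace X] [Nonempty X]
    (h4 : FourPoint (fun x y : X => dist x y)) (hp : HasPts X) : IsRealTree X := by
  refine ⟨inferInstance, ⟨inferInstance, ?_⟩, h4⟩
  intro a b
  have hp' : ∀ t : unitInterval, ∃ x : X, dist a x = t * dist a b ∧
      dist x b = dist a b - t * dist a b := fun t =>
    hp a b _ (mul_nonneg t.2.1 dist_nonneg) (mul_le_of_le_one_left dist_nonneg t.2.2)
  choose γ h1 h2 using hp'
  have harc : ∀ t, γ t ∈ arcSet a b := fun t => by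
    simp only [arcSet, mem_ofPred_eq, h1, h2]; ring
  refine ⟨⟨⟨γ, ?_⟩, ?_, ?_⟩⟩
  · refine (LipschitzWith.of_dist_le_mul (K := (dist a b).toNNReal) ?_).continuous
    intro s t
    have := arc_dist h4 (harc s) (harc t)
    rw [h1, h1, ← sub_mul, abs_mul, abs_of_nonneg (dist_nonneg (x := a) (y := b))] at this
    rw [Real.coe_toNNReal _ dist_nonneg, Subtype.dist_eq, Real.dist_eq, mul_comm]
    exact this
  · have := h1 0
    simp at this
    exact this.symm
  · have := h2 1
    simpa using this

lemma gh_approx {p q : GHSpace} {δ : ℝ} (h : dist p q < δ) :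
    ∃ (f : p.Rep → q.Rep) (g : q.Rep → p.Rep),
      (∀ x y, |dist (f x) (f y) - dist x y| ≤ 2 * δ) ∧
      (∀ x y, |dist (g x) (g y) - dist x y| ≤ 2 * δ) ∧
      (∀ x z, |dist (f x) z - dist x (g z)| ≤ 2 * δ) := by
  obtain ⟨Φ, Ψ, hΦ, hΨ, hd⟩ := ghDist_eq_hausdorffDist p.Rep q.Rep
  rw [← GromovHausdorff.dist_ghDist p q] at hd
  rw [hd] at h
  have hfin : hausdorffEDist (range Φ) (range Ψ) ≠ ⊤ :=
    hausdorffEDist_ne_top_of_nonempty_of_bounded (range_nonempty _) (range_nonempty _)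
      (isCompact_range hΦ.continuous).isBounded (isCompact_range hΨ.continuous).isBounded
  have hf : ∀ x, ∃ y, dist (Φ x) (Ψ y) < δ := by
    intro x
    obtain ⟨_, ⟨y, rfl⟩, hy⟩ := exists_dist_lt_of_hausdorffDist_lt (mem_range_self x) h hfin
    exact ⟨y, hy⟩
  have hg : ∀ y, ∃ x, dist (Φ x) (Ψ y) < δ := by
    intro y
    obtain ⟨_, ⟨x, rfl⟩, hx⟩ := exists_dist_lt_of_hausdorffDist_lt' (mem_range_self y) h hfin
    exact ⟨x, hx⟩
  choose f hf using hf
  choose g hg using hg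
  refine ⟨f, g, ?_, ?_, ?_⟩
  · intro x y
    rw [← hΨ.dist_eq, ← hΦ.dist_eq, ← Real.dist_eq]
    refine (dist_dist_dist_le _ _ _ _).trans ?_
    rw [dist_comm, dist_comm (Ψ (f y))]
    linarith [hf x, hf y]
  · intro x y
    rw [← hΨ.dist_eq, ← hΦ.dist_eq, ← Real.dist_eq]
    refine (dist_dist_dist_le _ _ _ _).trans ?_
    linarith [hg x, hg y]
  · intro x y
    rw [← hΨ.dist_eq, ← hΦ.dist_eq, ← Real.dist_eq]
    refine (dist_dist_dist_le _ _ _ _).trans ?_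
    rw [dist_comm, dist_comm (Ψ y)]
    linarith [hf x, hg y]

lemma isClosed_trees : IsClosed {p : GHSpace | IsRealTree p.Rep} := by
  rw [← closure_subset_iff_isClosed]
  intro p hp
  rw [Metric.mem_closure_iff] at hp
  refine tree_of_hasPts ?_ ?_
  · intro a b c d
    simp only
    refine le_of_forall_pos_le_add fun δ hδ => ?_
    obtain ⟨q, hq, hpq⟩ := hp (δ / 8) (by linarith)
    obtain ⟨f, -, hf, -, -⟩ := gh_approx hpq
    have h4 := hq.2.2 (f a) (f b) (f c) (f d)
    simp only at h4
    have h1 := abs_le.1 (hf a b)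
    have h2 := abs_le.1 (hf c d)
    have h3 := abs_le.1 (hf a c)
    have h5 := abs_le.1 (hf b d)
    have h6 := abs_le.1 (hf a d)
    have h7 := abs_le.1 (hf b c)
    have h8 := le_max_left (dist a c + dist b d) (dist a d + dist b c)
    have h9 := le_max_right (dist a c + dist b d) (dist a d + dist b c)
    rcases le_max_iff.1 h4 with h | h <;> linarith
  · intro a b t ht0 htd
    let F : p.Rep → ℝ := fun x => |dist a x - t| + |dist x b - (dist a b - t)|
    have hF : Continuous F := by fun_prop
    obtain ⟨x, -, hx⟩ := isCompact_univ.exists_isMinOn (univ_nonempty (α := p.Rep)) hF.continuousOn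
    have hx0 : F x ≤ 0 := by
      refine le_of_forall_pos_le_add fun δ hδ => ?_
      obtain ⟨q, hq, hpq⟩ := hp (δ / 20) (by linarith)
      obtain ⟨f, g, hf, hg, hfg⟩ := gh_approx hpq
      have hab := abs_le.1 (hf a b)
      obtain ⟨z, hz1, hz2⟩ := hasPts_of_tree hq (f a) (f b) (min t (dist (f a) (f b)))
        (le_min ht0 dist_nonneg) (min_le_right _ _)
      have hm1 : min t (dist (f a) (f b)) ≤ t := min_le_left _ _
      have hm2 : t - 2 * (δ / 20) ≤ min t (dist (f a) (f b)) :=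
        le_min (by linarith) (by linarith)
      have h1 := abs_le.1 (hfg a z)
      have h2 := abs_le.1 (hfg b z)
      rw [dist_comm (f b), dist_comm b] at h2
      have h3 : F x ≤ F (g z) := hx (mem_univ _)
      have h4 : |dist a (g z) - t| ≤ 4 * (δ / 20) := abs_le.2 ⟨by linarith, by linarith⟩
      have h5 : |dist (g z) b - (dist a b - t)| ≤ 6 * (δ / 20) :=
        abs_le.2 ⟨by linarith, by linarith⟩
      have h6 : F (g z) ≤ 4 * (δ / 20) + 6 * (δ / 20) := add_le_add h4 h5
      linarith
    have e1 := abs_nonneg (dist a x - t)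
    have e2 := abs_nonneg (dist x b - (dist a b - t))
    have hx0' : |dist a x - t| + |dist x b - (dist a b - t)| ≤ 0 := hx0
    have e3 : |dist a x - t| = 0 := by linarith
    have e4 : |dist x b - (dist a b - t)| = 0 := by linarith
    rw [abs_eq_zero] at e3 e4
    exact ⟨x, by linarith, by linarith⟩

lemma arc_measure_le {X : Type*} [MetricSpace X] [MeasurableSpace X] [BorelSpace X]
    (h4 : FourPoint (fun x y : X => dist x y)) (a b : X) :
    Measure.hausdorffMeasure 1 (arcSet a b) ≤ ENNReal.ofReal (dist a b) := by
  haveI : Nonempty X := ⟨a⟩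
  have hinj : InjOn (fun x => dist a x) (arcSet a b) := by
    intro x hx y hy hxy
    have := arc_dist h4 hx hy
    simp only at hxy
    rw [hxy, sub_self, abs_zero] at this
    exact dist_le_zero.1 this
  set T : Set ℝ := (fun x => dist a x) '' arcSet a b with hT
  set f := Function.invFunOn (fun x => dist a x) (arcSet a b) with hf
  have hlip : LipschitzOnWith 1 f T := by
    refine LipschitzOnWith.of_dist_le_mul ?_
    intro s hs t ht
    have e1 := Function.invFunOn_eq hs
    have e2 := Function.invFunOn_eq ht
    have := arc_dist h4 (Function.invFunOn_mem hs) (Function.invFunOn_mem ht)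
    rw [e1, e2] at this
    simpa [Real.dist_eq] using this
  have hsub : arcSet a b ⊆ f '' T := by
    intro x hx
    exact ⟨dist a x, ⟨x, hx, rfl⟩, hinj.leftInvOn_invFunOn hx⟩
  have hTs : T ⊆ Icc 0 (dist a b) := by
    rintro _ ⟨x, hx, rfl⟩
    simp only [arcSet, mem_ofPred_eq] at hx
    exact ⟨dist_nonneg, by linarith [dist_nonneg (x := x) (y := b)]⟩
  calc Measure.hausdorffMeasure 1 (arcSet a b) ≤ Measure.hausdorffMeasure 1 (f '' T) :=
        measure_mono hsub
    _ ≤ _ := hlip.hausdorffMeasure_image_le zero_le_one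
    _ = Measure.hausdorffMeasure 1 T := by simp
    _ ≤ Measure.hausdorffMeasure 1 (Icc 0 (dist a b)) := measure_mono hTs
    _ = ENNReal.ofReal (dist a b) := by rw [hausdorffMeasure_real]; simp

/-- Pieces of arcs used in the packing bound. -/
def piece {X : Type*} [MetricSpace X] (a b : X) (s t : ℝ) : Set X :=
  arcSet a b ∩ {z | s ≤ dist z b ∧ dist z b ≤ t}

lemma piece_measure {X : Type*} [MetricSpace X] [MeasurableSpace X] [BorelSpace X]
    (hp : HasPts X) (a b : X) {s t : ℝ} (hs : 0 ≤ s) (ht : t ≤ dist a b) :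
    ENNReal.ofReal (t - s) ≤ Measure.hausdorffMeasure 1 (piece a b s t) := by
  have hsub : Icc s t ⊆ (fun z => dist z b) '' piece a b s t := by
    intro u hu
    obtain ⟨x, h1, h2⟩ := hp a b (dist a b - u) (by linarith [hu.2]) (by linarith [hu.1])
    have h3 : dist x b = u := by linarith
    refine ⟨x, ⟨?_, ?_⟩, h3⟩
    · simp only [arcSet, mem_ofPred_eq]; linarith
    · simp only [mem_ofPred_eq, h3]; exact hu
  have hlip : LipschitzOnWith 1 (fun z => dist z b) (piece a b s t) :=
    (LipschitzWith.dist_left b).lipschitzOnWith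
  calc ENNReal.ofReal (t - s) = Measure.hausdorffMeasure 1 (Icc s t) := by
        rw [hausdorffMeasure_real]; simp
    _ ≤ _ := measure_mono hsub
    _ ≤ _ := hlip.hausdorffMeasure_image_le zero_le_one
    _ = _ := by simp

lemma piece_closed {X : Type*} [MetricSpace X] (a b : X) (s t : ℝ) :
    IsClosed (piece a b s t) := by
  have h1 : IsClosed (arcSet a b) := isClosed_eq (by fun_prop) (by fun_prop)
  have h2 : IsClosed {z : X | s ≤ dist z b} := isClosed_le (by fun_prop) (by fun_prop)
  have h3 : IsClosed {z : X | dist z b ≤ t} := isClosed_le (by fun_prop) (by fun_prop)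
  exact h1.inter (h2.inter h3)

lemma piece_subset {X : Type*} [MetricSpace X] [Nonempty X] [CompactSpace X]
    (h4 : FourPoint (fun x y : X => dist x y)) {ε : ℝ} (hε : 0 < ε) {a b : X} {t : ℝ}
    (ht : t + ε ≤ dist a b) : piece a b ε t ⊆ trimmed X ε ∩ skeleton X := by
  rintro z ⟨hz, hz1, hz2⟩
  have hz' := hz
  simp only [arcSet, mem_ofPred_eq] at hz'
  have hza : ε ≤ dist a z := by linarith
  have hdiam : ε < Metric.diam (univ : Set X) := by
    have := Metric.dist_le_diam_of_mem (isCompact_univ (X := X)).isBounded (mem_univ a) (mem_univ b)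
    linarith
  constructor
  · rw [trimmed, if_pos hdiam, mem_iInter]
    intro ρ
    left
    rcases arc_split h4 ρ hz with h | h
    · exact ⟨a, h, by rwa [dist_comm]⟩
    · exact ⟨b, h, hz1⟩
  · simp only [skeleton, mem_iUnion]
    refine ⟨a, b, hz, ?_⟩
    rintro (rfl | h)
    · rw [dist_self] at hza; linarith
    · rw [mem_singleton_iff] at h
      rw [h, dist_self] at hz1; linarith

lemma packing {X : Type*} [MetricSpace X] [Nonempty X] [CompactSpace X]
    (h : IsRealTree X) {ε : ℝ} (hε : 0 < ε) (x₀ : X) (s : Finset X)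
    (h0 : ∀ x ∈ s, 5 * ε ≤ dist x₀ x)
    (hs : ∀ x ∈ s, ∀ y ∈ s, x ≠ y → 5 * ε ≤ dist x y) :
    s.card * ENNReal.ofReal ε ≤ lengthMeasure X (trimmed X ε) := by
  letI : MeasurableSpace X := borel X
  haveI : BorelSpace X := ⟨rfl⟩
  have hp := hasPts_of_tree h
  have h4 := h.2.2
  change _ ≤ (Measure.restrict (Measure.hausdorffMeasure 1) (skeleton X) : Measure X) _
  have hsub : (⋃ x ∈ s, piece x₀ x ε (2 * ε)) ⊆ trimmed X ε ∩ skeleton X := by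
    refine iUnion₂_subset fun x hx => piece_subset h4 hε ?_
    linarith [h0 x hx]
  calc s.card * ENNReal.ofReal ε = ∑ x ∈ s, ENNReal.ofReal (2 * ε - ε) := by
        rw [Finset.sum_const, nsmul_eq_mul]; congr 2; ring
    _ ≤ ∑ x ∈ s, Measure.hausdorffMeasure 1 (piece x₀ x ε (2 * ε)) :=
        Finset.sum_le_sum fun x hx => piece_measure hp _ _ hε.le (by linarith [h0 x hx])
    _ = Measure.hausdorffMeasure 1 (⋃ x ∈ s, piece x₀ x ε (2 * ε)) := by
        rw [measure_biUnion_finset]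
        · intro x hx y hy hxy
          refine Set.disjoint_left.2 ?_
          rintro z ⟨-, -, hz1⟩ ⟨-, -, hz2⟩
          have := hs x hx y hy hxy
          have h3 := dist_triangle_left x y z
          linarith
        · exact fun x _ => (piece_closed _ _ _ _).measurableSet
    _ = (Measure.hausdorffMeasure 1).restrict (skeleton X)
          (⋃ x ∈ s, piece x₀ x ε (2 * ε)) := by
        rw [Measure.restrict_eq_self _ (hsub.trans inter_subset_right)]
    _ ≤ _ := measure_mono (hsub.trans inter_subset_left)

lemma diam_bound {X : Type*} [MetricSpace X] [Nonempty X] [CompactSpace X]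
    (h : IsRealTree X) {ε : ℝ} (hε : 0 < ε) (a b : X) :
    ENNReal.ofReal (dist a b - 2 * ε) ≤ lengthMeasure X (trimmed X ε) := by
  letI : MeasurableSpace X := borel X
  haveI : BorelSpace X := ⟨rfl⟩
  have hp := hasPts_of_tree h
  change _ ≤ (Measure.restrict (Measure.hausdorffMeasure 1) (skeleton X) : Measure X) _
  have hsub := piece_subset h.2.2 hε (a := a) (b := b) (t := dist a b - ε) (by linarith)
  calc ENNReal.ofReal (dist a b - 2 * ε) = ENNReal.ofReal ((dist a b - ε) - ε) := by
        congr 1; ring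
    _ ≤ Measure.hausdorffMeasure 1 (piece a b ε (dist a b - ε)) :=
        piece_measure hp _ _ hε.le (by linarith)
    _ = (Measure.hausdorffMeasure 1).restrict (skeleton X) (piece a b ε (dist a b - ε)) := by
        rw [Measure.restrict_eq_self _ (hsub.trans inter_subset_right)]
    _ ≤ _ := measure_mono (hsub.trans inter_subset_left)

lemma exists_net {X : Type*} [MetricSpace X] {r : ℝ} (hr : 0 < r) (N : ℕ)
    (hN : ∀ s : Finset X, (∀ x ∈ s, ∀ y ∈ s, x ≠ y → r ≤ dist x y) → s.card ≤ N) :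
    ∃ s : Finset X, s.card ≤ N ∧ ∀ x, ∃ y ∈ s, dist x y < r := by
  classical
  by_contra hno
  push Not at hno
  have key : ∀ n : ℕ, ∃ s : Finset X, s.card = n ∧
      ∀ x ∈ s, ∀ y ∈ s, x ≠ y → r ≤ dist x y := by
    intro n
    induction n with
    | zero => exact ⟨∅, by simp⟩
    | succ n ih =>
      obtain ⟨s, hc, hs⟩ := ih
      obtain ⟨x, hx⟩ := hno s (hN s hs)
      have hxs : x ∉ s := fun h => by
        have := hx x h
        rw [dist_self] at this
        linarith
      refine ⟨insert x s, by rw [Finset.card_insert_of_notMem hxs, hc], ?_⟩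
      intro y hy z hz hyz
      rw [Finset.mem_insert] at hy hz
      rcases hy with rfl | hy <;> rcases hz with rfl | hz
      · exact absurd rfl hyz
      · exact hx z hz
      · rw [dist_comm]; exact hx y hy
      · exact hs y hy z hz hyz
  obtain ⟨s, hc, hs⟩ := key (N + 1)
  have := hN s hs
  omega

lemma net_of_measure {X : Type*} [MetricSpace X] [Nonempty X] [CompactSpace X]
    (h : IsRealTree X) {ε : ℝ} (hε : 0 < ε) {M : ℝ} (hM0 : 0 ≤ M)
    (hM : lengthMeasure X (trimmed X ε) ≤ ENNReal.ofReal M) :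
    ∃ s : Finset X, s.card ≤ ⌈M / ε⌉₊ + 1 ∧ ∀ x, ∃ y ∈ s, dist x y < 5 * ε := by
  classical
  refine exists_net (by linarith) _ fun s hs => ?_
  rcases s.eq_empty_or_nonempty with rfl | ⟨x₀, hx₀⟩
  · simp
  have := (packing h hε x₀ (s.erase x₀)
    (fun x hx => hs _ hx₀ _ (Finset.mem_of_mem_erase hx) (Finset.ne_of_mem_erase hx).symm)
    (fun x hx y hy => hs _ (Finset.mem_of_mem_erase hx) _ (Finset.mem_of_mem_erase hy))).trans hM
  rw [← ENNReal.ofReal_natCast, ← ENNReal.ofReal_mul (Nat.cast_nonneg _),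
    ENNReal.ofReal_le_ofReal_iff hM0, ← le_div_iff₀ hε] at this
  have h2 : (s.erase x₀).card ≤ ⌈M / ε⌉₊ := by exact_mod_cast this.trans (Nat.le_ceil _)
  rw [Finset.card_erase_of_mem hx₀] at h2
  omega

lemma measure_of_net {X : Type*} [MetricSpace X] [Nonempty X]
    (h4 : FourPoint (fun x y : X => dist x y)) {ε : ℝ} {D : ℝ}
    (hD : ∀ x y : X, dist x y ≤ D) (s : Finset X) (hs : ∀ x, ∃ y ∈ s, dist x y < ε) :
    lengthMeasure X (trimmed X ε) ≤ s.card * ENNReal.ofReal D := by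
  letI : MeasurableSpace X := borel X
  haveI : BorelSpace X := ⟨rfl⟩
  change (Measure.restrict (Measure.hausdorffMeasure 1) (skeleton X) : Measure X) _ ≤ _
  let ρ : X := Classical.arbitrary X
  have hsub : trimmed X ε ⊆ ⋃ x ∈ s, arcSet ρ x := by
    intro x hx
    have hx' : x ∈ trimmedAt X ε ρ := by
      rw [trimmed] at hx
      split_ifs at hx with hd
      · exact mem_iInter.1 hx ρ
      · exact Or.inr hx
    simp only [mem_iUnion]
    rcases hx' with ⟨y, hy, hxy⟩ | hx'
    · obtain ⟨z, hz, hyz⟩ := hs y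
      refine ⟨z, hz, ?_⟩
      have hx2 : x ∈ arcSet y ρ := by
        simp only [arcSet, mem_ofPred_eq] at hy ⊢
        rw [dist_comm y x, dist_comm x ρ, dist_comm y ρ]; linarith
      rcases arc_split h4 z hx2 with h | h
      · exfalso
        simp only [arcSet, mem_ofPred_eq] at h
        rw [dist_comm z y] at h
        linarith [dist_nonneg (x := z) (y := x)]
      · simp only [arcSet, mem_ofPred_eq] at h ⊢
        rw [dist_comm ρ x, dist_comm x z, dist_comm ρ z]; linarith
    · rw [mem_singleton_iff] at hx'
      obtain ⟨z, hz, -⟩ := hs ρ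
      exact ⟨z, hz, by simp [hx', arcSet]⟩
  calc (Measure.restrict (Measure.hausdorffMeasure 1) (skeleton X) : Measure X) (trimmed X ε)
      ≤ Measure.hausdorffMeasure 1 (trimmed X ε) := Measure.restrict_le_self _
    _ ≤ Measure.hausdorffMeasure 1 (⋃ x ∈ s, arcSet ρ x) := measure_mono hsub
    _ ≤ ∑ x ∈ s, Measure.hausdorffMeasure 1 (arcSet ρ x) := measure_biUnion_finset_le _ _
    _ ≤ ∑ x ∈ s, ENNReal.ofReal D := Finset.sum_le_sum fun x _ =>
        (arc_measure_le h4 ρ x).trans (ENNReal.ofReal_le_ofReal (hD _ _))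
    _ = _ := by rw [Finset.sum_const, nsmul_eq_mul]

lemma local_bound (p₀ : GHSpace) {ε : ℝ} (hε : 0 < ε) :
    ∃ C : ENNReal, C < ⊤ ∧ ∀ p : GHSpace, IsRealTree p.Rep → dist p p₀ < ε / 8 →
      lengthMeasure p.Rep (trimmed p.Rep ε) ≤ C := by
  classical
  obtain ⟨t, -, htf, ht⟩ := (isCompact_univ (X := p₀.Rep)).finite_cover_balls
    (show 0 < ε / 2 by linarith)
  refine ⟨htf.toFinset.card * ENNReal.ofReal (diam (univ : Set p₀.Rep) + ε),
    ENNReal.mul_lt_top (by simp) ENNReal.ofReal_lt_top, ?_⟩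
  intro p hp hpd
  obtain ⟨f, g, hf, -, hfg⟩ := gh_approx hpd
  refine (measure_of_net hp.2.2 (D := diam (univ : Set p₀.Rep) + ε) ?_
    (htf.toFinset.image g) ?_).trans ?_
  · intro x y
    have h1 := Metric.dist_le_diam_of_mem (isCompact_univ (X := p₀.Rep)).isBounded
      (mem_univ (f x)) (mem_univ (f y))
    have h2 := abs_le.1 (hf x y)
    linarith
  · intro x
    have := ht (mem_univ (f x))
    simp only [mem_iUnion, mem_ball] at this
    obtain ⟨z, hz, hxz⟩ := this
    refine ⟨g z, Finset.mem_image_of_mem _ (by simpa using hz), ?_⟩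
    have h2 := abs_le.1 (hfg x z)
    linarith
  · gcongr
    exact Finset.card_image_le

lemma totallyBounded_of_bound (E : Set GHSpace) (hE : ∀ p ∈ E, IsRealTree p.Rep)
    (M : ℝ → ℝ) (hM0 : ∀ ε, 0 < ε → 0 ≤ M ε)
    (hM : ∀ ε, 0 < ε → ∀ p ∈ E, lengthMeasure p.Rep (trimmed p.Rep ε) ≤ ENNReal.ofReal (M ε)) :
    TotallyBounded E := by
  have hpos : ∀ n : ℕ, (0 : ℝ) < 1 / ((n : ℝ) + 1) := fun n => Nat.one_div_pos_of_nat
  refine GromovHausdorff.totallyBounded (C := M 1 + 2)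
    (u := fun n : ℕ => 5 * (1 / ((n : ℝ) + 1)))
    (K := fun n => ⌈M (1 / ((n : ℝ) + 1)) / (1 / ((n : ℝ) + 1))⌉₊ + 1) ?_ ?_ ?_
  · simpa using (tendsto_one_div_add_atTop_nhds_zero_nat (𝕜 := ℝ)).const_mul 5
  · intro p hp
    have h0 := hM0 1 one_pos
    refine Metric.diam_le_of_forall_dist_le (by linarith) ?_
    intro x _ y _
    have := (diam_bound (hE p hp) one_pos x y).trans (hM 1 one_pos p hp)
    rw [ENNReal.ofReal_le_ofReal_iff h0] at this
    linarith
  · intro p hp n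
    obtain ⟨s, hc, hs⟩ := net_of_measure (hE p hp) (hpos n) (hM0 _ (hpos n)) (hM _ (hpos n) p hp)
    refine ⟨s, ?_, ?_⟩
    · simpa using (Nat.cast_le (α := Cardinal)).2 hc
    · intro x _
      obtain ⟨y, hy, hxy⟩ := hs x
      simp only [mem_iUnion, mem_ball]
      exact ⟨y, hy, hxy⟩

end Helpers

/-- A subset `E` of `(T, d_GH)` is relatively compact if and only if
`sup {μ^T(R_ε(T)) : T ∈ E} < ∞` for every `ε > 0`. -/
theorem treeSpace_relatively_compact_iff (E : Set TreeSpace) :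
    IsCompact (closure E) ↔
      ∀ ε : ℝ, 0 < ε →
        (⨆ p ∈ E, lengthMeasure (p : GromovHausdorff.GHSpace).Rep
          (trimmed (p : GromovHausdorff.GHSpace).Rep ε)) < ⊤ := by
  constructor
  · intro hc ε hε
    suffices h : ∃ C : ENNReal, C < ⊤ ∧ ∀ p ∈ closure E,
        lengthMeasure (p : GromovHausdorff.GHSpace).Rep
          (trimmed (p : GromovHausdorff.GHSpace).Rep ε) ≤ C by
      obtain ⟨C, hC, hb⟩ := h
      exact (iSup₂_le fun p hp => hb p (subset_closure hp)).trans_lt hC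
    refine hc.induction_on (p := fun S : Set TreeSpace => ∃ C : ENNReal, C < ⊤ ∧ ∀ p ∈ S,
        lengthMeasure (p : GromovHausdorff.GHSpace).Rep
          (trimmed (p : GromovHausdorff.GHSpace).Rep ε) ≤ C) ?_ ?_ ?_ ?_
    · exact ⟨0, by simp, by simp⟩
    · rintro S T hST ⟨C, hC, h⟩
      exact ⟨C, hC, fun p hp => h p (hST hp)⟩
    · rintro S T ⟨C, hC, h⟩ ⟨D, hD, h'⟩
      refine ⟨max C D, max_lt hC hD, ?_⟩
      rintro p (hp | hp)
      · exact (h p hp).trans (le_max_left _ _)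
      · exact (h' p hp).trans (le_max_right _ _)
    · intro p₀ _
      obtain ⟨C, hC, h⟩ := local_bound (p₀ : GromovHausdorff.GHSpace) hε
      refine ⟨ball p₀ (ε / 8), mem_nhdsWithin_of_mem_nhds (ball_mem_nhds _ (by linarith)), C, hC, ?_⟩
      intro p hp
      exact h p p.2 hp
  · intro h
    have htb : TotallyBounded ((Subtype.val : TreeSpace → GromovHausdorff.GHSpace) '' E) := by
      refine totallyBounded_of_bound _ ?_
        (fun ε => (⨆ p ∈ E, lengthMeasure (p : GromovHausdorff.GHSpace).Rep
          (trimmed (p : GromovHausdorff.GHSpace).Rep ε)).toReal)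
        (fun _ _ => ENNReal.toReal_nonneg) ?_
      · rintro _ ⟨p, -, rfl⟩
        exact p.2
      · rintro ε hε _ ⟨p, hp, rfl⟩
        rw [ENNReal.ofReal_toReal (h ε hε).ne]
        exact le_iSup₂ (f := fun (p : TreeSpace) (_ : p ∈ E) =>
          lengthMeasure (p : GromovHausdorff.GHSpace).Rep
            (trimmed (p : GromovHausdorff.GHSpace).Rep ε)) p hp
    have hK : IsCompact (closure ((Subtype.val : TreeSpace → GromovHausdorff.GHSpace) '' E)) :=
      isCompact_iff_totallyBounded_isComplete.2 ⟨htb.closure, isClosed_closure.isComplete⟩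
    have hK' := isClosed_trees.isClosedEmbedding_subtypeVal.isCompact_preimage hK
    refine hK'.of_isClosed_subset isClosed_closure ?_
    refine closure_minimal ?_ (isClosed_closure.preimage continuous_subtype_val)
    intro p hp
    exact subset_closure ⟨p, hp, rfl⟩
end

section
/- For each excursion e ∈ U¹, the quotient metric space (T_e, d_{T_e}) is a compact real tree, i.e., it is complete, path-connected, and satisfies the four point condition. -/
open Metric Set

/-- `e ∈ U¹`: a continuous excursion path of length `1`, i.e. `e(0) = 0`, `e(t) > 0` for
`0 < t < 1` and `e(t) = 0` for `t ≥ 1`. -/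
def MemU1 (e : ℝ → ℝ) : Prop :=
  Continuous e ∧ e 0 = 0 ∧ (∀ t : ℝ, 0 < t → t < 1 → 0 < e t) ∧ (∀ t : ℝ, 1 ≤ t → e t = 0)

/-- The pseudometric associated to an excursion:
`d_{T_e}(u₁,u₂) = e(u₁) - 2 inf_{u ∈ [u₁∧u₂, u₁∨u₂]} e(u) + e(u₂)`. -/
noncomputable def dTe (e : ℝ → ℝ) (u₁ u₂ : ℝ) : ℝ :=
  e u₁ + e u₂ - 2 * sInf (e '' Set.uIcc u₁ u₂)

lemma bddBelow_image_uIcc {e : ℝ → ℝ} (hc : Continuous e) (a b : ℝ) :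
    BddBelow (e '' Set.uIcc a b) :=
  (isCompact_uIcc.image hc).bddBelow

/-- The infimum of `e` between two points satisfies the ultrametric inequality. -/
lemma sInf_ultra {e : ℝ → ℝ} (hc : Continuous e) (a b c : ℝ) :
    sInf (e '' Set.uIcc a b) ≤ sInf (e '' Set.uIcc a c) ∨
    sInf (e '' Set.uIcc b c) ≤ sInf (e '' Set.uIcc a c) := by
  rw [← min_le_iff]
  apply le_csInf (Set.nonempty_uIcc.image e)
  rintro _ ⟨w, hw, rfl⟩
  rcases Set.uIcc_subset_uIcc_union_uIcc (b := b) hw with h | h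
  · exact (min_le_left _ _).trans (csInf_le (bddBelow_image_uIcc hc _ _) ⟨w, h, rfl⟩)
  · exact (min_le_right _ _).trans (csInf_le (bddBelow_image_uIcc hc _ _) ⟨w, h, rfl⟩)

/-- For `e ∈ U¹`, the quotient metric space `(T_e, d_{T_e})` of `[0,1]` is a compact real
tree: any metric space realizing the quotient of `([0,1], d_{T_e})` is compact, complete,
path-connected and satisfies the four point condition. -/
theorem quotient_of_excursion_is_compact_real_tree
    (e : ℝ → ℝ) (he : MemU1 e)
    (T : Type*) [MetricSpace T] (q : Set.Icc (0 : ℝ) 1 → T)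
    (hsurj : Function.Surjective q)
    (hdist : ∀ u v : Set.Icc (0 : ℝ) 1, dist (q u) (q v) = dTe e u v) :
    CompactSpace T ∧ IsRealTree T := by
  have hc : Continuous e := he.1
  have hq : Continuous q := by
    rw [Metric.continuous_iff]
    intro u ε hε
    obtain ⟨δ, hδ, h⟩ := Metric.continuous_iff.1 hc u (ε / 4) (by positivity)
    refine ⟨δ, hδ, fun v hv => ?_⟩
    rw [hdist, dTe]
    have hv' : dist (v : ℝ) u < δ := hv
    have h1 := h v hv'
    rw [Real.dist_eq, abs_lt] at h1
    have h2 : e u - ε / 4 ≤ sInf (e '' Set.uIcc (v : ℝ) u) := by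
      apply le_csInf (Set.nonempty_uIcc.image e)
      rintro _ ⟨w, hw, rfl⟩
      have h3 : dist w u < δ := by
        refine lt_of_le_of_lt ?_ hv'
        rw [Real.dist_eq, Real.dist_eq]
        rw [Set.uIcc_comm] at hw
        exact Set.abs_sub_left_of_mem_uIcc hw
      have h4 := h w h3
      rw [Real.dist_eq, abs_lt] at h4
      linarith
    linarith
  have hcomp : CompactSpace T := by
    rw [← isCompact_univ_iff, ← hsurj.range_eq]
    exact isCompact_range hq
  have hpc : PathConnectedSpace (Set.Icc (0 : ℝ) 1) :=
    isPathConnected_iff_pathConnectedSpace.1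
      ((convex_Icc (0 : ℝ) 1).isPathConnected ⟨0, by simp⟩)
  refine ⟨hcomp, inferInstance, hsurj.pathConnectedSpace hq, ?_⟩
  intro x₁ x₂ x₃ x₄
  obtain ⟨a, rfl⟩ := hsurj x₁
  obtain ⟨b, rfl⟩ := hsurj x₂
  obtain ⟨c, rfl⟩ := hsurj x₃
  obtain ⟨d, rfl⟩ := hsurj x₄
  simp only [hdist, dTe]
  have h1 := sInf_ultra hc a c b
  have h2 := sInf_ultra hc a d b
  have h3 := sInf_ultra hc c a d
  have h4 := sInf_ultra hc c b d
  rw [Set.uIcc_comm (c : ℝ) b] at h1 h4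
  rw [Set.uIcc_comm (d : ℝ) b] at h2
  rw [Set.uIcc_comm (c : ℝ) a] at h3
  rw [le_max_iff]
  by_contra! hcon
  obtain ⟨k1, k2⟩ := hcon
  rcases h1 with h1 | h1 <;> rcases h2 with h2 | h2 <;> rcases h3 with h3 | h3 <;>
    rcases h4 with h4 | h4 <;> linarith
end

section
/- For each e ∈ U¹, the function d_{T_e}(u₁,u₂) := e(u₁) − 2·inf_{u ∈ [u₁∧u₂, u₁∨u₂]} e(u) + e(u₂) is a pseudometric on [0,1], and it satisfies the four point inequality: for all u₁,u₂,u₃,u₄ ∈ [0,1], max{d_{T_e}(u₁,u₃) + d_{T_e}(u₂,u₄), d_{T_e}(u₁,u₄) + d_{T_e}(u₂,u₃)} ≥ d_{T_e}(u₁,u₂) + d_{T_e}(u₃,u₄). -/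
open Metric Set

theorem sInf_aux_le (e : ℝ → ℝ) (hc : Continuous e) (u v x : ℝ) (hx : x ∈ Set.uIcc u v) :
    sInf (e '' Set.uIcc u v) ≤ e x :=
  csInf_le (isCompact_uIcc.image hc).bddBelow ⟨x, hx, rfl⟩

theorem sInf_aux_ultra (e : ℝ → ℝ) (hc : Continuous e) (u v w : ℝ) :
    sInf (e '' Set.uIcc u v) ≤ sInf (e '' Set.uIcc u w) ∨
      sInf (e '' Set.uIcc v w) ≤ sInf (e '' Set.uIcc u w) := by
  rw [← min_le_iff]
  refine le_csInf (Set.nonempty_uIcc.image e) ?_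
  rintro _ ⟨x, hx, rfl⟩
  rw [min_le_iff]
  rcases Set.uIcc_subset_uIcc_union_uIcc (b := v) hx with h | h
  · exact Or.inl (sInf_aux_le e hc _ _ _ h)
  · exact Or.inr (sInf_aux_le e hc _ _ _ h)

theorem four_aux (a b c d p q : ℝ)
    (h1 : min b d ≤ a) (h2 : min c q ≤ a) (h3 : min b c ≤ p) (h4 : min d q ≤ p)
    (h5 : min a d ≤ b) (h6 : min c p ≤ b) (h7 : min a q ≤ c) (h8 : min b p ≤ c)
    (h9 : min a b ≤ d) (h10 : min q p ≤ d) (h11 : min a c ≤ q) (h12 : min d p ≤ q) :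
    b + q ≤ a + p ∨ c + d ≤ a + p := by
  by_contra! h
  grind

/-- For `e ∈ U¹`, `d_{T_e}` is a pseudometric on `[0,1]` (vanishing on the diagonal,
nonnegative, symmetric, triangle inequality) and satisfies the four point inequality. -/
theorem dTe_pseudometric_and_four_point (e : ℝ → ℝ) (he : MemU1 e) :
    (∀ u ∈ Set.Icc (0 : ℝ) 1, dTe e u u = 0) ∧
    (∀ u ∈ Set.Icc (0 : ℝ) 1, ∀ v ∈ Set.Icc (0 : ℝ) 1, 0 ≤ dTe e u v) ∧
    (∀ u ∈ Set.Icc (0 : ℝ) 1, ∀ v ∈ Set.Icc (0 : ℝ) 1, dTe e u v = dTe e v u) ∧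
    (∀ u ∈ Set.Icc (0 : ℝ) 1, ∀ v ∈ Set.Icc (0 : ℝ) 1, ∀ w ∈ Set.Icc (0 : ℝ) 1,
      dTe e u w ≤ dTe e u v + dTe e v w) ∧
    (∀ u₁ ∈ Set.Icc (0 : ℝ) 1, ∀ u₂ ∈ Set.Icc (0 : ℝ) 1, ∀ u₃ ∈ Set.Icc (0 : ℝ) 1,
      ∀ u₄ ∈ Set.Icc (0 : ℝ) 1,
      dTe e u₁ u₂ + dTe e u₃ u₄ ≤
        max (dTe e u₁ u₃ + dTe e u₂ u₄) (dTe e u₁ u₄ + dTe e u₂ u₃)) := by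
  have hc := he.1
  have hs : ∀ u v : ℝ, sInf (e '' Set.uIcc u v) = sInf (e '' Set.uIcc v u) := fun u v => by
    rw [Set.uIcc_comm]
  have hl : ∀ u v : ℝ, sInf (e '' Set.uIcc u v) ≤ e u := fun u v =>
    sInf_aux_le e hc u v u Set.left_mem_uIcc
  have hr : ∀ u v : ℝ, sInf (e '' Set.uIcc u v) ≤ e v := fun u v =>
    sInf_aux_le e hc u v v Set.right_mem_uIcc
  have hu : ∀ u v w : ℝ, min (sInf (e '' Set.uIcc u v)) (sInf (e '' Set.uIcc v w)) ≤
      sInf (e '' Set.uIcc u w) := fun u v w => min_le_iff.2 (sInf_aux_ultra e hc u v w)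
  unfold dTe
  refine ⟨?_, ?_, ?_, ?_, ?_⟩
  · intro u _
    simp
    ring
  · intro u _ v _
    linarith [hl u v, hr u v]
  · intro u _ v _
    rw [hs u v]
    ring
  · intro u _ v _ w _
    rcases sInf_aux_ultra e hc u v w with h | h
    · linarith [hl v w]
    · linarith [hr u v]
  · intro x _ y _ z _ w _
    have key := four_aux (sInf (e '' Set.uIcc x y)) (sInf (e '' Set.uIcc x z))
      (sInf (e '' Set.uIcc x w)) (sInf (e '' Set.uIcc y z)) (sInf (e '' Set.uIcc z w))
      (sInf (e '' Set.uIcc y w))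
      (by simpa only [hs z y] using hu x z y) (by simpa only [hs w y] using hu x w y)
      (by simpa only [hs z x] using hu z x w) (by simpa only [hs z y] using hu z y w)
      (hu x y z) (by simpa only [hs w z] using hu x w z)
      (hu x y w) (hu x z w)
      (by simpa only [hs y x] using hu y x z) (by simpa only [hs w z] using hu y w z)
      (by simpa only [hs y x] using hu y x w) (hu y z w)
    rw [le_max_iff]
    rcases key with h | h
    · left; linarith
    · right; linarith
end

section
/- Every compact real tree (T,d) containing more than one point is isometric to T_e for some e ∈ U¹, where T_e is the quotient of [0,1] by the pseudometric d_{T_e} associated to the excursion e. -/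
open Metric Set

section Helpers

variable {T : Type*} [MetricSpace T]

/-- Four point condition as a disjunction. -/
def FP (T : Type*) [MetricSpace T] : Prop :=
  ∀ x y z w : T, dist x y + dist z w ≤ dist x z + dist y w ∨
    dist x y + dist z w ≤ dist x w + dist y z

/-- Existence of points on geodesics. -/
def SegP (T : Type*) [MetricSpace T] : Prop :=
  ∀ (a b : T) (s : ℝ), 0 ≤ s → s ≤ dist a b → ∃ m : T, dist a m = s ∧ dist m b = dist a b - s

/-- Ultrametric inequality for Gromov products. -/
lemma FP.gp (H : FP T) (m a b c : T) (k : ℝ)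
    (h1 : k ≤ dist m a + dist m b - dist a b) (h2 : k ≤ dist m b + dist m c - dist b c) :
    k ≤ dist m a + dist m c - dist a c := by
  rcases H a c m b with h | h
  · rw [dist_comm a m, dist_comm c b] at h; linarith
  · rw [dist_comm c m] at h; linarith

lemma FP.gp_lt (H : FP T) (m a b c : T) (k : ℝ)
    (h1 : k < dist m a + dist m b - dist a b) (h2 : k < dist m b + dist m c - dist b c) :
    k < dist m a + dist m c - dist a c := by
  rcases H a c m b with h | h
  · rw [dist_comm a m, dist_comm c b] at h; linarith
  · rw [dist_comm c m] at h; linarith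

lemma segP_of [CompactSpace T] [PreconnectedSpace T] (H : FP T) : SegP T := by
  intro a b s hs hsb
  set g : T → ℝ := fun x => dist a b + dist a x - dist b x with hg
  have gc : Continuous g := by fun_prop
  have hga : g a = 0 := by simp [hg, dist_comm]
  have hgb : g b = 2 * dist a b := by simp [hg]; ring
  rcases hs.eq_or_lt with rfl | hs0
  · exact ⟨a, by simp, by simp⟩
  set C : Set T := {x | g x = 2 * s} with hC
  have Ccl : IsClosed C := isClosed_eq gc continuous_const
  have Cne : C.Nonempty := by
    have := intermediate_value_univ a b gc (show 2 * s ∈ Icc (g a) (g b) from ⟨by linarith, by linarith⟩)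
    obtain ⟨x, hx⟩ := this
    exact ⟨x, hx⟩
  obtain ⟨x, hxC, hx⟩ := Ccl.isCompact.exists_isMinOn Cne
    (f := fun x => dist a x) (by fun_prop)
  have hxC' : dist a b + dist a x - dist b x = 2 * s := hxC
  have hge : s ≤ dist a x := by
    have := dist_triangle a x b
    rw [dist_comm x b] at this; linarith
  rcases hge.eq_or_lt with h | h
  · refine ⟨x, h.symm, ?_⟩
    rw [dist_comm x b]; linarith
  exfalso
  have hop : IsOpen C := by
    rw [Metric.isOpen_iff]
    intro y hy
    have hy' : dist a b + dist a y - dist b y = 2 * s := hy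
    have hyx : dist a x ≤ dist a y := hx hy
    refine ⟨dist a x - s, by linarith, ?_⟩
    intro z hz
    rw [mem_ball] at hz
    have h1 : 2 * s < dist a y + dist a z - dist y z := by
      have := dist_triangle a z y
      rw [dist_comm y z]; linarith
    have h2 := H.gp a b y z (2 * s) (by linarith) h1.le
    show dist a b + dist a z - dist b z = 2 * s
    by_contra hne
    have h3 : 2 * s < dist a b + dist a z - dist b z := lt_of_le_of_ne h2 (Ne.symm hne)
    have := H.gp_lt a b z y (2 * s) h3 (by rw [dist_comm z y]; linarith)
    linarith
  have : C = univ := IsClopen.eq_univ ⟨Ccl, hop⟩ Cne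
  have ha : a ∈ C := by rw [this]; trivial
  have : g a = 2 * s := ha
  linarith

/-- A continuous path passes through each point of the geodesic between its endpoints. -/
lemma cut (H : FP T) {q : ℝ → T} (hq : Continuous q) {u v : ℝ} (m : T)
    (hm : dist (q u) m + dist m (q v) = dist (q u) (q v)) : ∃ w ∈ uIcc u v, q w = m := by
  by_contra hcon
  push Not at hcon
  set a := q u with ha
  have hpre : IsPreconnected (q '' uIcc u v) := isPreconnected_uIcc.image q hq.continuousOn
  set U : Set T := {y | 0 < dist m a + dist m y - dist a y}
  set V : Set T := {y | y ≠ m ∧ dist m a + dist m y - dist a y ≤ 0}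
  have hU : IsOpen U := isOpen_lt continuous_const (by fun_prop)
  have hV : IsOpen V := by
    rw [Metric.isOpen_iff]
    rintro y ⟨hy, hy2⟩
    refine ⟨dist y m, dist_pos.2 hy, ?_⟩
    intro z hz
    rw [mem_ball] at hz
    refine ⟨?_, ?_⟩
    · rintro rfl
      rw [dist_comm] at hz; exact lt_irrefl _ hz
    · by_contra hlt
      push Not at hlt
      have hzm : z ≠ m := by
        rintro rfl
        rw [dist_comm] at hz; exact lt_irrefl _ hz
      have := dist_pos.2 hzm
      have := H.gp_lt m a z y 0 hlt (by rw [dist_comm m y, dist_comm m z]; linarith)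
      linarith
  obtain ⟨y, -, hy1, hy2, hy3⟩ := hpre U V hU hV
    (by
      rintro _ ⟨w, hw, rfl⟩
      by_cases h : 0 < dist m a + dist m (q w) - dist a (q w)
      · exact Or.inl h
      · exact Or.inr ⟨hcon w hw, not_lt.1 h⟩)
    ⟨a, ⟨u, left_mem_uIcc, rfl⟩, by
      have : 0 < dist m a := dist_pos.2 (Ne.symm (hcon u left_mem_uIcc))
      show 0 < dist m a + dist m a - dist a a
      rw [dist_self]; linarith⟩
    ⟨q v, ⟨v, right_mem_uIcc, rfl⟩, hcon v right_mem_uIcc, by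
      rw [dist_comm m a]; linarith⟩
  exact absurd (show 0 < dist m a + dist m y - dist a y from hy1) (not_lt.2 hy3)

/-- The contour property with respect to a root. -/
def PP (ρ : T) (q : ℝ → T) : Prop :=
  ∀ u w v : ℝ, u ≤ w → w ≤ v →
    dist ρ (q u) + dist ρ (q v) - dist (q u) (q v) ≤ 2 * dist ρ (q w)

lemma dTe_eq_aux (H : FP T) (S : SegP T) {ρ : T} {q : ℝ → T} (hq : Continuous q) (hP : PP ρ q)
    (u v : ℝ) (huv : u ≤ v) : dist (q u) (q v) = dTe (fun t => dist ρ (q t)) u v := by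
  set g := (dist ρ (q u) + dist ρ (q v) - dist (q u) (q v)) / 2 with hg
  have hleast : IsLeast ((fun t => dist ρ (q t)) '' uIcc u v) g := by
    constructor
    · have t1 := dist_triangle ρ (q u) (q v)
      have t2 := dist_triangle ρ (q v) (q u)
      have t3 := dist_triangle (q u) ρ (q v)
      rw [dist_comm (q v) (q u)] at t2
      rw [dist_comm (q u) ρ] at t3
      obtain ⟨m, hm1, hm2⟩ := S (q u) (q v) (dist ρ (q u) - g) (by linarith) (by linarith)
      obtain ⟨w, hw, hwm⟩ := cut H hq m (u := u) (v := v) (by linarith)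
      refine ⟨w, hw, ?_⟩
      show dist ρ (q w) = g
      rw [hwm]
      apply le_antisymm
      · rcases H ρ m (q u) (q v) with h | h
        · linarith
        · rw [dist_comm m (q u)] at h; linarith
      · have := dist_triangle ρ m (q u)
        rw [dist_comm m (q u)] at this; linarith
    · rintro _ ⟨w, hw, rfl⟩
      rw [uIcc_of_le huv] at hw
      have := hP u w v hw.1 hw.2
      show g ≤ dist ρ (q w)
      linarith
  unfold dTe
  rw [hleast.csInf_eq]
  linarith

lemma dTe_eq (H : FP T) (S : SegP T) {ρ : T} {q : ℝ → T} (hq : Continuous q) (hP : PP ρ q)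
    (u v : ℝ) : dist (q u) (q v) = dTe (fun t => dist ρ (q t)) u v := by
  rcases le_total u v with h | h
  · exact dTe_eq_aux H S hq hP u v h
  · rw [dist_comm, dTe_eq_aux H S hq hP v u h]
    unfold dTe
    rw [uIcc_comm]; ring

/-- Contours supported in `[0, L]`. -/
structure SS (ρ : T) (L : ℝ) (q : ℝ → T) : Prop where
  cont : Continuous q
  pp : PP ρ q
  left : ∀ s, s ≤ 0 → q s = ρ
  right : ∀ s, L ≤ s → q s = ρ

/-- gate property -/
lemma gate (H : FP T) (S : SegP T) {q : ℝ → T} (hq : Continuous q) {p x : T}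
    (hp : p ∈ range q) (hmin : ∀ z ∈ range q, dist x p ≤ dist x z) (y : T)
    (hy : dist p y + dist y x = dist p x) (z : T) (hz : z ∈ range q) :
    dist y z = dist y p + dist p z := by
  obtain ⟨t, rfl⟩ := hp
  obtain ⟨s, rfl⟩ := hz
  set p := q t
  set z := q s
  set g := (dist p z + dist p x - dist z x) / 2 with hg
  have t1 := dist_triangle p z x
  have t2 := dist_triangle p x z
  have t3 := dist_triangle z p x
  rw [dist_comm x z] at t2
  rw [dist_comm z p] at t3
  obtain ⟨m, hm1, hm2⟩ := S p z g (by linarith) (by linarith)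
  obtain ⟨w, hw, hwm⟩ := cut H hq m (u := t) (v := s) (by
    show dist p m + dist m z = dist p z
    linarith)
  have h1 := hmin m ⟨w, hwm⟩
  have h2 : dist x m ≤ dist p x - g := by
    rcases H x m p z with h | h
    · rw [dist_comm x p] at h; linarith
    · rw [dist_comm m p, dist_comm x z] at h; linarith
  have h3 : g = 0 := by
    rw [dist_comm x p] at h1; linarith
  have t4 := dist_triangle z y x
  have t5 := dist_triangle y p z
  rw [dist_comm z y] at t4
  rw [dist_comm y p] at t5 ⊢
  linarith

lemma geodesic (H : FP T) (S : SegP T) (p x : T) :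
    ∃ c : ℝ → T, (∀ a ∈ Icc 0 (dist p x), dist p (c a) = a ∧ dist (c a) x = dist p x - a) ∧
      (∀ a ∈ Icc 0 (dist p x), ∀ b ∈ Icc 0 (dist p x), dist (c a) (c b) = |a - b|) := by
  have : Nonempty T := ⟨p⟩
  choose! c hc using S p x
  refine ⟨c, fun a ha => hc a ha.1 ha.2, fun a ha b hb => ?_⟩
  obtain ⟨a1, a2⟩ := hc a ha.1 ha.2
  obtain ⟨b1, b2⟩ := hc b hb.1 hb.2
  apply le_antisymm
  · rcases H (c a) (c b) p x with h | h
    · rw [dist_comm (c a) p] at h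
      have := le_abs_self (a - b)
      linarith
    · rw [dist_comm (c b) p] at h
      have := neg_le_abs (a - b)
      linarith
  · rw [abs_le']
    have t1 := dist_triangle p (c a) (c b)
    have t2 := dist_triangle p (c b) (c a)
    rw [dist_comm (c b) (c a)] at t2
    constructor <;> linarith

/-- Insert an excursion to `x`. -/
lemma insertion [CompactSpace T] (H : FP T) (S : SegP T) {ρ : T} {L : ℝ} (hL : 0 ≤ L) {q : ℝ → T}
    (hq : SS ρ L q) (x : T) {δ : ℝ} (hδ : 0 < δ) :
    ∃ (q' : ℝ → T) (ψ : ℝ → ℝ), SS ρ (L + δ) q' ∧ (∀ s, |ψ s - s| ≤ δ) ∧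
      x ∈ range q' ∧ range q ⊆ range q' ∧
      ∀ s, ∀ z ∈ range q, dist (q' s) z = dist (q' s) (q (ψ s)) + dist (q (ψ s)) z := by
  have hρ : ρ ∈ range q := ⟨0, hq.left 0 le_rfl⟩
  have hcomp : IsCompact (q '' Icc 0 L) := isCompact_Icc.image hq.cont
  have hreq : range q = q '' Icc 0 L := by
    apply subset_antisymm _ (image_subset_range _ _)
    rintro _ ⟨s, rfl⟩
    by_cases h : s ∈ Icc 0 L
    · exact ⟨s, h, rfl⟩
    · refine ⟨0, ⟨le_rfl, hL⟩, ?_⟩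
      rw [hq.left 0 le_rfl]
      rcases le_total s 0 with h0 | h0
      · rw [hq.left s h0]
      · rw [hq.right s (by by_contra hc; exact h ⟨h0, by linarith⟩)]
  obtain ⟨p, hpm, hpmin⟩ := hcomp.exists_isMinOn ⟨q 0, 0, ⟨le_rfl, hL⟩, rfl⟩
    (f := fun y => dist x y) (by fun_prop)
  obtain ⟨t, ht, htp⟩ := hpm
  have hp : p ∈ range q := ⟨t, htp⟩
  have hG := gate H S hq.cont hp (x := x) (fun z hz => hpmin (by rwa [hreq] at hz))
  obtain ⟨c, hc, hcc⟩ := geodesic H S p x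
  set ℓ := dist p x with hℓ
  have hℓ0 : 0 ≤ ℓ := dist_nonneg
  set ψ : ℝ → ℝ := fun s => max (min s t) (s - δ) with hψ
  have ψc : Continuous ψ := by fun_prop
  have ψm : Monotone ψ := by
    intro a b hab
    exact max_le_max (min_le_min hab le_rfl) (by linarith)
  set h : ℝ → ℝ := fun s => max 0 (min (s - t) (t + δ - s)) * (2 * ℓ / δ) with hh
  have hcont : Continuous h := by fun_prop
  have hK : 0 ≤ 2 * ℓ / δ := by positivity
  have h0 : ∀ s, 0 ≤ h s := fun s => mul_nonneg (le_max_left _ _) hK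
  have hl : ∀ s, h s ≤ ℓ := by
    intro s
    have : max 0 (min (s - t) (t + δ - s)) ≤ δ / 2 := by
      apply max_le (by linarith)
      rcases le_total (s - t) (δ / 2) with h | h
      · exact (min_le_left _ _).trans h
      · exact (min_le_right _ _).trans (by linarith)
    calc h s ≤ δ / 2 * (2 * ℓ / δ) := mul_le_mul_of_nonneg_right this hK
      _ = ℓ := by field_simp
  have hI : ∀ s, h s ∈ Icc 0 ℓ := fun s => ⟨h0 s, hl s⟩
  set G : Set ℝ := Icc t (t + δ) with hGdef
  have hout : ∀ s, s ∉ G → h s = 0 := by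
    intro s hs
    have : max 0 (min (s - t) (t + δ - s)) = 0 := by
      apply max_eq_left
      by_contra hcon
      push Not at hcon
      rw [lt_min_iff] at hcon
      exact hs ⟨by linarith, by linarith⟩
    simp only [hh, this, zero_mul]
  have hin : ∀ s ∈ G, q (ψ s) = p := by
    intro s hs
    have : ψ s = t := by
      simp only [hψ]
      rw [min_eq_right hs.1, max_eq_left (by linarith [hs.2])]
    rw [this, htp]
  have huni : ∀ u w v, u ≤ w → w ≤ v → min (h u) (h v) ≤ h w := by
    intro u w v huw hwv
    have : min (max 0 (min (u - t) (t + δ - u))) (max 0 (min (v - t) (t + δ - v))) ≤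
        max 0 (min (w - t) (t + δ - w)) := by
      grind
    simp only [hh]
    rw [← min_mul_of_nonneg _ _ hK]
    exact mul_le_mul_of_nonneg_right this hK
  classical
  set q' : ℝ → T := fun s => if s ∈ G then c (h s) else q (ψ s) with hq'
  have qin : ∀ s ∈ G, q' s = c (h s) := fun s hs => if_pos hs
  have qout : ∀ s, s ∉ G → q' s = q (ψ s) := fun s hs => if_neg hs
  -- distance from a new point to old points
  have D1 : ∀ s, dist (q' s) (q (ψ s)) = h s := by
    intro s
    by_cases hs : s ∈ G
    · rw [qin s hs, hin s hs, dist_comm]; exact (hc _ (hI s)).1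
    · rw [qout s hs, hout s hs, dist_self]
  have D2 : ∀ s, ∀ z ∈ range q, dist (q' s) z = dist (q' s) (q (ψ s)) + dist (q (ψ s)) z := by
    intro s z hz
    by_cases hs : s ∈ G
    · rw [hin s hs, qin s hs]
      have := hc _ (hI s)
      exact hG (c (h s)) (by linarith) z hz
    · rw [qout s hs, dist_self, zero_add]
  have D3 : ∀ u v, u ∈ G → v ∈ G → dist (q' u) (q' v) = |h u - h v| := by
    intro u v hu hv
    rw [qin u hu, qin v hv]
    exact hcc _ (hI u) _ (hI v)
  have D4 : ∀ u v, ¬ (u ∈ G ∧ v ∈ G) →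
      dist (q' u) (q' v) = dist (q (ψ u)) (q (ψ v)) + h u + h v := by
    intro u v huv
    by_cases hv : v ∈ G
    · have hu : u ∉ G := fun hu => huv ⟨hu, hv⟩
      rw [qout u hu, dist_comm, D2 v _ (mem_range_self _), D1, hout u hu,
        dist_comm (q (ψ v))]
      ring
    · rw [qout v hv, D2 u _ (mem_range_self _), D1, hout v hv]
      ring
  have D5 : ∀ u, dist ρ (q' u) = dist ρ (q (ψ u)) + h u := by
    intro u
    rw [dist_comm, D2 u ρ hρ, D1, dist_comm ρ]; ring
  refine ⟨q', ψ, ⟨?_, ?_, ?_, ?_⟩, ?_, ?_, ?_, D2⟩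
  · -- continuity
    rw [continuous_iff_continuousAt]
    intro v
    rw [ContinuousAt, tendsto_iff_dist_tendsto_zero]
    have hbound : ∀ u, dist (q' u) (q' v) ≤ |h u - h v| + dist (q (ψ u)) (q (ψ v)) := by
      intro u
      by_cases huv : u ∈ G ∧ v ∈ G
      · rw [D3 u v huv.1 huv.2]
        linarith [dist_nonneg (x := q (ψ u)) (y := q (ψ v))]
      · rw [D4 u v huv]
        by_cases hu : u ∈ G
        · have hv : v ∉ G := fun hv => huv ⟨hu, hv⟩
          rw [hout v hv]
          have := le_abs_self (h u - 0)
          linarith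
        · rw [hout u hu]
          have := neg_le_abs (0 - h v)
          linarith
    have hlim : Filter.Tendsto (fun u => |h u - h v| + dist (q (ψ u)) (q (ψ v))) (nhds v)
        (nhds 0) := by
      have hqc := hq.cont
      have : Continuous (fun u => |h u - h v| + dist (q (ψ u)) (q (ψ v))) := by fun_prop
      have := this.tendsto v
      simpa using this
    exact squeeze_zero (fun _ => dist_nonneg) hbound hlim
  · intro u w v huw hwv
    rw [D5, D5, D5]
    by_cases huv : u ∈ G ∧ v ∈ G
    · have hw : w ∈ G := ⟨huv.1.1.trans huw, hwv.trans huv.2.2⟩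
      rw [D3 u v huv.1 huv.2, hin u huv.1, hin v huv.2, hin w hw]
      have := huni u w v huw hwv
      rcases min_le_iff.1 this with h1 | h1
      · have := neg_le_abs (h u - h v)
        linarith
      · have := le_abs_self (h u - h v)
        linarith
    · rw [D4 u v huv]
      have := hq.pp (ψ u) (ψ w) (ψ v) (ψm huw) (ψm hwv)
      linarith [h0 w]
  · intro s hs
    have e1 : ψ s = s := by
      simp only [hψ]
      rw [min_eq_left (hs.trans ht.1), max_eq_left (by linarith)]
    have e2 : h s = 0 := by
      have : max 0 (min (s - t) (t + δ - s)) = 0 :=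
        max_eq_left ((min_le_left _ _).trans (by linarith [ht.1]))
      simp only [hh, this, zero_mul]
    have := D5 s
    rw [e1, e2, hq.left s hs, dist_self, add_zero] at this
    exact (dist_eq_zero.1 this).symm
  · intro s hs
    have e1 : ψ s = s - δ := by
      simp only [hψ]
      exact max_eq_right ((min_le_right _ _).trans (by linarith [ht.2]))
    have e2 : h s = 0 := by
      have : max 0 (min (s - t) (t + δ - s)) = 0 :=
        max_eq_left ((min_le_right _ _).trans (by linarith [ht.2]))
      simp only [hh, this, zero_mul]
    have := D5 s
    rw [e1, e2, hq.right (s - δ) (by linarith), dist_self, add_zero] at this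
    exact (dist_eq_zero.1 this).symm
  · intro s
    simp only [hψ]
    rw [abs_le]
    constructor
    · linarith [le_max_right (min s t) (s - δ)]
    · have : max (min s t) (s - δ) ≤ s := max_le (min_le_left _ _) (by linarith)
      linarith
  · refine ⟨t + δ / 2, ?_⟩
    have hs : t + δ / 2 ∈ G := ⟨by linarith, by linarith⟩
    have e : h (t + δ / 2) = ℓ := by
      have : max 0 (min (t + δ / 2 - t) (t + δ - (t + δ / 2))) = δ / 2 := by
        have : t + δ / 2 - t = δ / 2 := by ring
        rw [this]
        have : t + δ - (t + δ / 2) = δ / 2 := by ring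
        rw [this, min_self]
        exact max_eq_right (by linarith)
      simp only [hh, this]
      field_simp
    rw [qin _ hs, e]
    have := (hc ℓ ⟨hℓ0, le_rfl⟩).2
    rw [sub_self] at this
    exact dist_eq_zero.1 this
  · rintro _ ⟨s, rfl⟩
    rcases le_or_gt s t with hst | hst
    · refine ⟨s, ?_⟩
      have e1 : ψ s = s := by
        simp only [hψ]
        rw [min_eq_left hst, max_eq_left (by linarith)]
      have e2 : h s = 0 := by
        have : max 0 (min (s - t) (t + δ - s)) = 0 :=
          max_eq_left ((min_le_left _ _).trans (by linarith))
        simp only [hh, this, zero_mul]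
      have := D1 s
      rw [e1, e2] at this
      exact dist_eq_zero.1 this
    · refine ⟨s + δ, ?_⟩
      have hs : s + δ ∉ G := fun hh => by linarith [hh.2]
      rw [qout _ hs]
      congr 1
      simp only [hψ]
      rw [max_eq_right]
      · ring
      · exact (min_le_right _ _).trans (by linarith)

lemma multi [CompactSpace T] (H : FP T) (S : SegP T) {ρ : T} {L : ℝ} (hL : 0 ≤ L) {q : ℝ → T}
    (hq : SS ρ L q) {F : Set T} (hF : F.Finite) : ∀ δ : ℝ, 0 < δ →
    ∃ (q' : ℝ → T) (φ : ℝ → ℝ), SS ρ (L + δ) q' ∧ (∀ s, |φ s - s| ≤ δ) ∧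
      F ⊆ range q' ∧ range q ⊆ range q' ∧
      ∀ s, ∀ z ∈ range q, dist (q' s) (q (φ s)) ≤ dist (q' s) z := by
  induction F, hF using Set.Finite.induction_on with
  | empty =>
    intro δ hδ
    refine ⟨q, id, ⟨hq.cont, hq.pp, hq.left, fun s hs => hq.right s (by linarith)⟩, ?_,
      empty_subset _, subset_rfl, ?_⟩
    · intro s; simpa using hδ.le
    · intro s z _; simp
  | @insert x F _ _ ih =>
    intro δ hδ
    obtain ⟨q', φ, h1, h2, h3, h4, h5⟩ := ih (δ / 2) (by linarith)
    obtain ⟨q'', ψ, k1, k2, k3, k4, k5⟩ := insertion H S (by linarith) h1 x (half_pos hδ)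
    refine ⟨q'', φ ∘ ψ, ?_, ?_, ?_, h4.trans k4, ?_⟩
    · rw [add_assoc, add_halves] at k1; exact k1
    · intro s
      have a1 := h2 (ψ s)
      have a2 := k2 s
      have : (φ ∘ ψ) s - s = (φ (ψ s) - ψ s) + (ψ s - s) := by simp
      rw [this]
      exact (abs_add_le _ _).trans (by linarith)
    · exact insert_subset k3 (h3.trans k4)
    · intro s z hz
      rw [k5 s z (h4 hz)]
      have := h5 (ψ s) z hz
      have t := dist_triangle (q'' s) (q' (ψ s)) (q (φ (ψ s)))
      simp only [Function.comp]
      linarith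

lemma SS.unif {ρ : T} {L : ℝ} (hL : 0 ≤ L) {q : ℝ → T} (hq : SS ρ L q) : UniformContinuous q := by
  have : q = (fun s : Icc (0:ℝ) L => q s) ∘ (projIcc 0 L hL) := by
    funext s
    simp only [Function.comp]
    rcases le_total s 0 with h | h
    · rw [projIcc_of_le_left hL h, hq.left s h, hq.left 0 le_rfl]
    · rcases le_total L s with h' | h'
      · rw [projIcc_of_right_le hL h', hq.right s h', hq.right L le_rfl]
      · rw [projIcc_of_mem hL ⟨h, h'⟩]
  rw [this]
  have c1 : UniformContinuous (fun s : Icc (0:ℝ) L => q s) :=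
    CompactSpace.uniformContinuous_of_continuous (hq.cont.comp continuous_subtype_val)
  exact c1.comp (LipschitzWith.projIcc hL).uniformContinuous

lemma step [CompactSpace T] (H : FP T) (S : SegP T) {ρ : T} {L : ℝ} (hL : 0 ≤ L) {q : ℝ → T}
    (hq : SS ρ L q) {r η : ℝ} (hη : 0 < η) (hr : ∀ x, ∃ y ∈ range q, dist x y ≤ r) :
    ∃ q' : ℝ → T, SS ρ (L + η) q' ∧ (∀ s, dist (q s) (q' s) ≤ r + η) ∧
      ∀ x, ∃ y ∈ range q', dist x y ≤ η := by
  obtain ⟨F, -, hF, hFc⟩ := Metric.finite_approx_of_totallyBounded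
    (isCompact_univ (X := T)).totallyBounded η hη
  obtain ⟨δ, hδ, hδq⟩ := Metric.uniformContinuous_iff.1 (hq.unif hL) η hη
  obtain ⟨q', φ, h1, h2, h3, h4, h5⟩ := multi H S hL hq hF (min η (δ / 2)) (by positivity)
  refine ⟨q', ⟨h1.cont, h1.pp, h1.left, fun s hs => h1.right s ?_⟩, ?_, ?_⟩
  · linarith [min_le_left η (δ / 2)]
  · intro s
    obtain ⟨y, hy, hyr⟩ := hr (q' s)
    have a1 := h5 s y hy
    have a2 : dist (φ s) s < δ := by
      rw [Real.dist_eq]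
      exact (h2 s).trans_lt ((min_le_right _ _).trans_lt (by linarith))
    have a3 := hδq a2
    have t := dist_triangle (q s) (q (φ s)) (q' s)
    rw [dist_comm (q s) (q (φ s)), dist_comm (q (φ s)) (q' s)] at t
    linarith
  · intro x
    have := hFc (mem_univ x)
    simp only [mem_iUnion] at this
    obtain ⟨y, hy, hxy⟩ := this
    exact ⟨y, h3 hy, (mem_ball.1 hxy).le⟩

lemma exists_contour [CompactSpace T] (H : FP T) (S : SegP T) (ρ : T) :
    ∃ (D : ℝ) (q : ℝ → T), 0 ≤ D ∧ SS ρ D q ∧ Function.Surjective q := by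
  obtain ⟨D, hD0, hD⟩ : ∃ D : ℝ, 0 < D ∧ ∀ x, dist x ρ ≤ D := by
    refine ⟨Metric.diam (univ : Set T) + 1, by linarith [Metric.diam_nonneg (s := (univ : Set T))],
      fun x => ?_⟩
    have := Metric.dist_le_diam_of_mem (isCompact_univ (X := T)).isBounded (mem_univ x) (mem_univ ρ)
    linarith
  let r : ℕ → ℝ := fun n => D / 2 ^ n
  have r0 : ∀ n, 0 < r n := fun n => by positivity
  have rs : ∀ n, r (n + 1) = r n / 2 := fun n => by simp only [r, pow_succ]; field_simp
  have rD : ∀ n, r n ≤ D := fun n => div_le_self hD0.le (one_le_pow₀ (by norm_num))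
  let St : ℕ → (ℝ → T) → Prop := fun n q =>
    SS ρ (D - r n) q ∧ ∀ x, ∃ y ∈ range q, dist x y ≤ r n
  have hstep : ∀ n q, St n q → ∃ q', St (n + 1) q' ∧ ∀ s, dist (q s) (q' s) ≤ 2 * D / 2 ^ n := by
    rintro n q ⟨h1, h2⟩
    obtain ⟨q', k1, k2, k3⟩ := step H S (by linarith [rD n]) h1 (r0 (n + 1)) h2
    refine ⟨q', ⟨?_, k3⟩, fun s => (k2 s).trans ?_⟩
    · have : D - r (n + 1) = D - r n + r (n + 1) := by rw [rs]; ring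
      rw [this]; exact k1
    · have : 2 * D / 2 ^ n = 2 * r n := by simp only [r]; ring
      rw [this, rs]; linarith [r0 n]
  have hinit : St 0 (fun _ => ρ) := by
    refine ⟨⟨continuous_const, ?_, fun _ _ => rfl, fun _ _ => rfl⟩, fun x => ⟨ρ, ⟨0, rfl⟩, ?_⟩⟩
    · intro u w v _ _; simp
    · simpa [r] using hD x
  choose! nx hnx1 hnx2 using hstep
  let Q : ℕ → (ℝ → T) := fun n => Nat.rec (fun _ => ρ) (fun n q => nx n q) n
  have hQ : ∀ n, St n (Q n) := by
    intro n
    induction n with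
    | zero => exact hinit
    | succ n ih => exact hnx1 n _ ih
  have hQd : ∀ s n, dist (Q n s) (Q (n + 1) s) ≤ 4 * D / 2 / 2 ^ n := by
    intro s n
    have := hnx2 n _ (hQ n) s
    have e : 4 * D / 2 / 2 ^ n = 2 * D / 2 ^ n := by ring
    rw [e]; exact this
  have hcau : ∀ s, CauchySeq (fun n => Q n s) := fun s => cauchySeq_of_le_geometric_two (hQd s)
  choose q hq using fun s => cauchySeq_tendsto_of_complete (hcau s)
  have hqd : ∀ s n, dist (Q n s) (q s) ≤ 4 * D / 2 ^ n := fun s n =>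
    dist_le_of_le_geometric_two_of_tendsto (hQd s) (hq s) n
  have hto0 : Filter.Tendsto (fun n : ℕ => 4 * D / 2 ^ n) Filter.atTop (nhds 0) := by
    have := (tendsto_pow_atTop_nhds_zero_of_lt_one (r := (1/2 : ℝ)) (by norm_num)
      (by norm_num)).const_mul (4 * D)
    simp only [mul_zero] at this
    refine this.congr fun n => ?_
    rw [one_div, inv_pow]; rfl
  have hunif : TendstoUniformly Q q Filter.atTop := by
    rw [Metric.tendstoUniformly_iff]
    intro ε hε
    filter_upwards [hto0.eventually (gt_mem_nhds hε)] with n hn s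
    rw [dist_comm]
    exact (hqd s n).trans_lt hn
  have hqc : Continuous q := hunif.continuous (Filter.Frequently.of_forall fun n => (hQ n).1.cont)
  have hSS : SS ρ D q := by
    refine ⟨hqc, ?_, ?_, ?_⟩
    · intro u w v huw hwv
      refine le_of_tendsto_of_tendsto'
        (((tendsto_const_nhds.dist (hq u)).add (tendsto_const_nhds.dist (hq v))).sub
          ((hq u).dist (hq v))) ((tendsto_const_nhds.dist (hq w)).const_mul 2)
        fun n => (hQ n).1.pp u w v huw hwv
    · intro s hs
      refine tendsto_nhds_unique (hq s) ?_
      simp only [(hQ _).1.left s hs]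
      exact tendsto_const_nhds
    · intro s hs
      refine tendsto_nhds_unique (hq s) ?_
      have : ∀ n, Q n s = ρ := fun n => (hQ n).1.right s (by linarith [r0 n])
      simp only [this]
      exact tendsto_const_nhds
  refine ⟨D, q, hD0.le, hSS, ?_⟩
  have hcl : IsClosed (q '' Icc 0 D) := (isCompact_Icc.image hqc).isClosed
  intro x
  suffices x ∈ q '' Icc 0 D by
    obtain ⟨s, -, hs⟩ := this; exact ⟨s, hs⟩
  rw [← hcl.closure_eq, Metric.mem_closure_iff]
  intro ε hε
  obtain ⟨n, hn⟩ := (hto0.eventually (gt_mem_nhds (half_pos hε))).exists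
  obtain ⟨_, ⟨s, rfl⟩, hy⟩ := (hQ n).2 x
  refine ⟨q s, ?_, ?_⟩
  · by_cases h : s ∈ Icc 0 D
    · exact ⟨s, h, rfl⟩
    · refine ⟨0, ⟨le_rfl, hD0.le⟩, ?_⟩
      rw [hSS.left 0 le_rfl]
      rcases le_total s 0 with h0 | h0
      · rw [hSS.left s h0]
      · rw [hSS.right s (by by_contra hc; exact h ⟨h0, by linarith⟩)]
  · have t := dist_triangle x (Q n s) (q s)
    have := hqd s n
    have e : r n ≤ 4 * D / 2 ^ n := by
      have : 4 * D / 2 ^ n = 4 * r n := by simp only [r]; ring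
      linarith [r0 n]
    linarith

end Helpers

/-- Every compact real tree with more than one point is isometric to `T_e` for some
`e ∈ U¹`: there are an excursion `e ∈ U¹` and a surjection `q : [0,1] → T` realizing `T`
as the quotient of `([0,1], d_{T_e})`. -/
theorem compact_real_tree_is_quotient_of_excursion
    (T : Type*) [MetricSpace T] [CompactSpace T] [Nonempty T]
    (hT : IsRealTree T) (hcard : ∃ x y : T, x ≠ y) :
    ∃ e : ℝ → ℝ, MemU1 e ∧
      ∃ q : Set.Icc (0 : ℝ) 1 → T, Function.Surjective q ∧
        ∀ u v : Set.Icc (0 : ℝ) 1, dist (q u) (q v) = dTe e u v := by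
  obtain ⟨-, hpc, h4⟩ := hT
  have H : FP T := fun x y z w => by
    have := h4 x y z w
    simpa only [le_max_iff] using this
  have S : SegP T := segP_of H
  -- the root
  obtain ⟨⟨ρ, y₀⟩, -, hmax⟩ := (isCompact_univ (X := T × T)).exists_isMaxOn univ_nonempty
    (f := fun z : T × T => dist z.1 z.2) (by fun_prop)
  have hmax' : ∀ a b : T, dist a b ≤ dist ρ y₀ := fun a b => hmax (mem_univ (a, b))
  have hleaf : ∀ x y : T, x ≠ ρ → y ≠ ρ → 0 < dist ρ x + dist ρ y - dist x y := by
    intro x y hx hy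
    have hx' := dist_pos.2 hx.symm
    have hy' := dist_pos.2 hy.symm
    refine H.gp_lt ρ x y₀ y 0 ?_ ?_
    · linarith [hmax' x y₀]
    · linarith [hmax' y₀ y]
  obtain ⟨D, q, hD0, hq, hsurj⟩ := exists_contour H S ρ
  set U : Set ℝ := {t | q t ≠ ρ} with hU
  have hUo : IsOpen U := isOpen_ne_fun hq.cont continuous_const
  have hUne : U.Nonempty := by
    obtain ⟨x, y, hxy⟩ := hcard
    by_contra hemp
    rw [not_nonempty_iff_eq_empty] at hemp
    have : ∀ t, q t = ρ := fun t => by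
      by_contra h
      have : t ∈ U := h
      rw [hemp] at this; exact this
    obtain ⟨s, rfl⟩ := hsurj x
    obtain ⟨t, rfl⟩ := hsurj y
    exact hxy (by rw [this, this])
  have hUb : U ⊆ Icc 0 D := by
    intro t ht
    constructor
    · by_contra h
      exact ht (hq.left t (by linarith))
    · by_contra h
      exact ht (hq.right t (by linarith))
  have hbb : BddBelow U := bddBelow_Icc.mono hUb
  have hba : BddAbove U := bddAbove_Icc.mono hUb
  set a := sInf U
  set b := sSup U
  have ha : ∀ t ≤ a, q t = ρ := by
    intro t ht
    by_contra h
    have h' : U ∈ nhds t := hUo.mem_nhds h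
    obtain ⟨ε, hε, hb⟩ := Metric.mem_nhds_iff.1 h'
    have : t - ε / 2 ∈ U := hb (by rw [mem_ball, Real.dist_eq, abs_lt]; constructor <;> linarith)
    have := csInf_le hbb this
    linarith
  have hb : ∀ t, b ≤ t → q t = ρ := by
    intro t ht
    by_contra h
    have h' : U ∈ nhds t := hUo.mem_nhds h
    obtain ⟨ε, hε, hb⟩ := Metric.mem_nhds_iff.1 h'
    have : t + ε / 2 ∈ U := hb (by rw [mem_ball, Real.dist_eq, abs_lt]; constructor <;> linarith)
    have := le_csSup hba this
    linarith
  have hab : a < b := by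
    obtain ⟨t, ht⟩ := hUne
    have h1 : a < t := by
      by_contra h
      exact ht (ha t (not_lt.1 h))
    have h2 : t < b := by
      by_contra h
      exact ht (hb t (not_lt.1 h))
    linarith
  have hmid : ∀ t, a < t → t < b → 0 < dist ρ (q t) := by
    intro t h1 h2
    obtain ⟨u, hu, hut⟩ := exists_lt_of_csInf_lt hUne h1
    obtain ⟨v, hv, hvt⟩ := exists_lt_of_lt_csSup hUne h2
    have := hq.pp u t v hut.le hvt.le
    have := hleaf (q u) (q v) hu hv
    linarith
  set k : ℝ → ℝ := fun s => a + s * (b - a) with hk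
  have kc : Continuous k := by fun_prop
  have km : Monotone k := fun x y hxy => by
    have := mul_le_mul_of_nonneg_right hxy (sub_nonneg.2 hab.le)
    simp only [hk]; linarith
  have hqk : Continuous (q ∘ k) := hq.cont.comp kc
  have hPk : PP ρ (q ∘ k) := fun u w v huw hwv => hq.pp _ _ _ (km huw) (km hwv)
  refine ⟨fun t => dist ρ ((q ∘ k) t), ⟨continuous_const.dist hqk, ?_, ?_, ?_⟩, fun s => (q ∘ k) s, ?_, ?_⟩
  · have : k 0 = a := by simp [hk]
    simp only [Function.comp, this, ha a le_rfl, dist_self]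
  · intro t h1 h2
    apply hmid
    · have : 0 < t * (b - a) := mul_pos h1 (by linarith)
      simp only [hk]; linarith
    · have : 0 < (1 - t) * (b - a) := mul_pos (by linarith) (by linarith)
      simp only [hk]; linarith
  · intro t ht
    have h1 : b ≤ k t := by
      have : 0 ≤ (t - 1) * (b - a) := mul_nonneg (by linarith) (by linarith)
      simp only [hk]; linarith
    simp only [Function.comp, hb _ h1, dist_self]
  · intro x
    by_cases hx : x = ρ
    · refine ⟨⟨0, by simp⟩, ?_⟩
      have : k 0 = a := by simp [hk]
      simp only [Function.comp, this, ha a le_rfl, hx]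
    · obtain ⟨t, rfl⟩ := hsurj x
      have h1 : a < t := by
        by_contra h
        exact hx (ha t (not_lt.1 h))
      have h2 : t < b := by
        by_contra h
        exact hx (hb t (not_lt.1 h))
      have hba' : 0 < b - a := by linarith
      refine ⟨⟨(t - a) / (b - a), div_nonneg (by linarith) hba'.le,
        (div_le_one hba').2 (by linarith)⟩, ?_⟩
      have : k ((t - a) / (b - a)) = t := by
        simp only [hk]; field_simp; ring
      simp only [Function.comp, this]
  · intro u v
    exact dTe_eq H S hqk hPk u v
end

section
/- Fix ε > 3δ > 0. For a > 0 let V_{ε,a} := {T : T is a compact real tree with μ^T(R_ε(T)) > a}, and let V_{ε,a}^δ := {S : S is a compact real tree with d_GH(S, T) < δ for some T ∈ V_{ε,a}}. Then ∩_{a>0} V_{ε,a}^δ = ∅; that is, for every compact real tree S there exists a > 0 such that d_GH(S, T) ≥ δ for every compact real tree T with μ^T(R_ε(T)) > a. -/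
open Metric Set

theorem arc_hausdorff_le {X : Type*} [MetricSpace X] [MeasurableSpace X] [BorelSpace X]
    (h4 : FourPoint (fun x y : X => dist x y)) (a b : X) :
    MeasureTheory.Measure.hausdorffMeasure 1 (arcSet a b) ≤ ENNReal.ofReal (dist a b) := by
  let f : arcSet a b → ℝ := fun x => dist a x.1
  have hf : AntilipschitzWith 1 f := by
    apply AntilipschitzWith.of_le_mul_dist
    rintro ⟨x, hx⟩ ⟨y, hy⟩
    have h := h4 x y a b
    have hx' : dist a x + dist x b = dist a b := hx
    have hy' : dist a y + dist y b = dist a b := hy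
    simp only [NNReal.coe_one, one_mul, Real.dist_eq, f, Subtype.dist_eq]
    simp only [dist_comm x a, dist_comm y a] at h
    have h1 := le_abs_self (dist a x - dist a y)
    have h2 := neg_le_abs (dist a x - dist a y)
    rcases le_max_iff.1 h with h | h <;> linarith
  have h1 := hf.le_hausdorffMeasure_image (d := 1) zero_le_one Set.univ
  have h2 : MeasureTheory.Measure.hausdorffMeasure 1 (arcSet a b)
      = MeasureTheory.Measure.hausdorffMeasure 1 (Set.univ : Set (arcSet a b)) := by
    have := (isometry_subtype_coe (s := arcSet a b)).hausdorffMeasure_image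
      (d := 1) (Or.inl zero_le_one) Set.univ
    rw [← this, Set.image_univ, Subtype.range_coe]
  rw [h2]
  refine h1.trans ?_
  have h3 : f '' Set.univ ⊆ Set.Icc 0 (dist a b) := by
    rintro _ ⟨⟨x, hx⟩, -, rfl⟩
    have hx' : dist a x + dist x b = dist a b := hx
    exact ⟨dist_nonneg, by
      have := dist_nonneg (x := x) (y := b)
      show dist a x ≤ _
      linarith⟩
  have h5 := MeasureTheory.measure_mono
    (μ := (MeasureTheory.Measure.hausdorffMeasure 1 : MeasureTheory.Measure ℝ)) h3
  rw [MeasureTheory.hausdorffMeasure_real, Real.volume_Icc, sub_zero] at h5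
  rw [MeasureTheory.hausdorffMeasure_real]
  simpa using h5

theorem trimmedAt_subset {X : Type*} [MetricSpace X]
    (h4 : FourPoint (fun x y : X => dist x y)) {ε : ℝ} {ι : Type*} (N : Set ι) (f : ι → X)
    (hne : N.Nonempty) (hN : ∀ y, ∃ i ∈ N, dist y (f i) < ε) (ρ : X) :
    trimmedAt X ε ρ ⊆ ⋃ i ∈ N, arcSet ρ (f i) := by
  rintro x (⟨y, hxy, hε⟩ | hx)
  · obtain ⟨i, hi, hlt⟩ := hN y
    refine Set.mem_biUnion hi ?_
    have hxy' : dist ρ x + dist x y = dist ρ y := hxy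
    have h := h4 ρ y x (f i)
    have ht := dist_triangle ρ x (f i)
    have hd := dist_nonneg (x := x) (y := f i)
    simp only [dist_comm y x] at h
    show dist ρ x + dist x (f i) = dist ρ (f i)
    rcases le_max_iff.1 h with h | h <;> linarith
  · obtain ⟨i, hi⟩ := hne
    refine Set.mem_biUnion hi ?_
    rw [Set.mem_singleton_iff.1 hx]
    simp [arcSet]

/-- Fix `ε > 3δ > 0`. For every compact real tree `S` there is an `a > 0` such that
`d_GH(S,T) ≥ δ` for every compact real tree `T` with `μ^T(R_ε(T)) > a`; that is,
`⋂_{a>0} V_{ε,a}^δ = ∅` where `V_{ε,a} = {T : μ^T(R_ε(T)) > a}`. -/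
theorem exists_a_ghDist_ge_of_trimmed_length_gt
    (ε δ : ℝ) (hδ : 0 < δ) (hεδ : 3 * δ < ε)
    (S : Type) [MetricSpace S] [CompactSpace S] [Nonempty S] (hS : IsRealTree S) :
    ∃ a : ℝ, 0 < a ∧
      ∀ (T : Type) [MetricSpace T] [CompactSpace T] [Nonempty T],
        IsRealTree T →
        ENNReal.ofReal a < lengthMeasure T (trimmed T ε) →
        δ ≤ GromovHausdorff.ghDist S T := by
  obtain ⟨N, -, hNf, hNc⟩ :=
    Metric.finite_approx_of_totallyBounded (isCompact_univ (X := S)).totallyBounded δ hδ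
  obtain ⟨s0⟩ := ‹Nonempty S›
  have hnet : ∀ s : S, ∃ s' ∈ N, dist s s' < δ := by
    intro s
    simpa using hNc (Set.mem_univ s)
  have hNne : N.Nonempty := (hnet s0).imp fun _ h => h.1
  set D : ℝ := 2 * δ + Metric.diam (Set.univ : Set S) with hD
  have hDpos : 0 < D := by
    have := Metric.diam_nonneg (s := (Set.univ : Set S))
    linarith
  refine ⟨hNf.toFinset.card * D + 1, by positivity, ?_⟩
  intro T _ _ _ hT hlt
  by_contra! hGH
  rw [← GromovHausdorff.hausdorffDist_optimal] at hGH
  set Φ := GromovHausdorff.optimalGHInjl S T with hΦ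
  set Ψ := GromovHausdorff.optimalGHInjr S T with hΨ
  have iΦ : Isometry Φ := GromovHausdorff.isometry_optimalGHInjl S T
  have iΨ : Isometry Ψ := GromovHausdorff.isometry_optimalGHInjr S T
  have hfin : hausdorffEDist (range Φ) (range Ψ) ≠ ⊤ :=
    hausdorffEDist_ne_top_of_nonempty_of_bounded ⟨_, ⟨s0, rfl⟩⟩ (range_nonempty Ψ)
      (isCompact_range iΦ.continuous).isBounded (isCompact_range iΨ.continuous).isBounded
  have hf : ∀ s : S, ∃ t : T, dist (Φ s) (Ψ t) < δ := by
    intro s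
    obtain ⟨_, ⟨t, rfl⟩, h⟩ := exists_dist_lt_of_hausdorffDist_lt (mem_range_self s) hGH hfin
    exact ⟨t, h⟩
  choose f hf using hf
  have hcov : ∀ y : T, ∃ s ∈ N, dist y (f s) < ε := by
    intro y
    obtain ⟨_, ⟨s, rfl⟩, h⟩ := exists_dist_lt_of_hausdorffDist_lt' (mem_range_self y) hGH hfin
    obtain ⟨s', hs', h'⟩ := hnet s
    refine ⟨s', hs', ?_⟩
    rw [← iΨ.dist_eq]
    rw [← iΦ.dist_eq] at h'
    have h1 := dist_triangle4 (Ψ y) (Φ s) (Φ s') (Ψ (f s'))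
    have h2 := hf s'
    rw [dist_comm] at h
    linarith
  have hlen : ∀ s : S, dist (f s0) (f s) ≤ D := by
    intro s
    rw [← iΨ.dist_eq]
    have h1 := dist_triangle4 (Ψ (f s0)) (Φ s0) (Φ s) (Ψ (f s))
    have h2 := hf s
    have h3 := hf s0
    rw [dist_comm] at h3
    rw [iΦ.dist_eq] at h1
    have h4 := Metric.dist_le_diam_of_mem (isCompact_univ (X := S)).isBounded
      (Set.mem_univ s0) (Set.mem_univ s)
    linarith
  letI : MeasurableSpace T := borel T
  haveI : BorelSpace T := ⟨rfl⟩
  have hle : lengthMeasure T (trimmed T ε)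
      ≤ MeasureTheory.Measure.hausdorffMeasure 1 (trimmed T ε) :=
    MeasureTheory.Measure.restrict_le_self _
  refine absurd (hlt.trans_le hle) (not_lt.2 ?_)
  unfold trimmed
  split_ifs with hdiam
  · calc MeasureTheory.Measure.hausdorffMeasure 1 (⋂ ρ : T, trimmedAt T ε ρ)
        ≤ MeasureTheory.Measure.hausdorffMeasure 1
            (⋃ s ∈ hNf.toFinset, arcSet (f s0) (f s)) := by
          apply MeasureTheory.measure_mono
          refine (Set.iInter_subset _ (f s0)).trans ?_
          simpa using trimmedAt_subset hT.2.2 N f hNne hcov (f s0)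
      _ ≤ ∑ s ∈ hNf.toFinset,
            MeasureTheory.Measure.hausdorffMeasure 1 (arcSet (f s0) (f s)) :=
          MeasureTheory.measure_biUnion_finset_le _ _
      _ ≤ ∑ s ∈ hNf.toFinset, ENNReal.ofReal D :=
          Finset.sum_le_sum fun s _ => (arc_hausdorff_le hT.2.2 _ _).trans
            (ENNReal.ofReal_le_ofReal (hlen s))
      _ = ENNReal.ofReal (hNf.toFinset.card * D) := by
          rw [Finset.sum_const, nsmul_eq_mul, ENNReal.ofReal_mul (by positivity),
            ENNReal.ofReal_natCast]
      _ ≤ _ := ENNReal.ofReal_le_ofReal (by linarith)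
  · haveI := MeasureTheory.Measure.nullSingletonClass_hausdorff T (zero_lt_one (α := ℝ))
    rw [MeasureTheory.measure_singleton]
    exact bot_le
end

section
/- Let (T,d,ν) be a weighted compact real tree and u,v ∈ T, and let d̄(T,d,ν) := ∫_T ∫_T d(x,y) ν(dx) ν(dy) be the ν-averaged distance. Then the change in averaged distance under the subtree prune and regraft operation satisfies |d̄(T,d,ν) − d̄(T,d^{(u,v)},ν)| ≤ 2 ν(S^{T,u,v}) ν(T ∖ S^{T,u,v}) d(u,v). -/
open Metric Set

/-- The subtree `S^{T,u,v} = {w : u ∈ ]v,w[}` of points on the other side of `u`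
from `v`. -/
def sprSubtree {X : Type*} [MetricSpace X] (u v : X) : Set X :=
  {w | u ∈ openArc v w}

open Classical in
/-- The subtree prune and regraft distance `d^{(u,v)}`: the subtree `S^{T,u,v}` rooted at
`u` is pruned and regrafted at `v`. -/
noncomputable def dSPR {X : Type*} [MetricSpace X] (u v : X) (x y : X) : ℝ :=
  if x ∈ sprSubtree u v ∧ y ∈ sprSubtree u v then dist x y
  else if x ∉ sprSubtree u v ∧ y ∉ sprSubtree u v then dist x y
  else if x ∈ sprSubtree u v then dist x u + dist v y
  else dist y u + dist v x

/-- The `ν`-averaged distance `∫∫ ρ(x,y) ν(dx) ν(dy)` for a distance function `ρ`. -/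
noncomputable def avgDist {X : Type*} [MeasurableSpace X] (ρ : X → X → ℝ)
    (ν : MeasureTheory.Measure X) : ℝ :=
  ∫ x, ∫ y, ρ x y ∂ν ∂ν

open MeasureTheory in
theorem measurableSet_sprSubtree' {T : Type*} [MetricSpace T] [MeasurableSpace T] [BorelSpace T]
    (u v : T) : MeasurableSet (sprSubtree u v) := by
  have h : sprSubtree u v = {w | dist v u + dist u w = dist v w} ∩ ({w | u ≠ v} ∩ {u}ᶜ) := by
    ext w
    simp only [sprSubtree, openArc, arcSet, mem_setOf_eq, mem_diff, mem_insert_iff,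
      mem_singleton_iff, mem_inter_iff, mem_compl_iff, not_or]
    rw [eq_comm (a := w) (b := u)]
  rw [h]
  refine MeasurableSet.inter ?_ ((MeasurableSet.const _).inter (measurableSet_singleton u).compl)
  exact (isClosed_eq (by fun_prop) (by fun_prop)).measurableSet

theorem spr_cross_bound {T : Type*} [MetricSpace T]
    (hT : FourPoint (fun x y : T => dist x y)) (u v x y : T)
    (hx : x ∈ sprSubtree u v) (hy : y ∉ sprSubtree u v) :
    |dist x y - (dist x u + dist v y)| ≤ dist u v := by
  simp only [sprSubtree, openArc, arcSet, mem_setOf_eq, mem_diff, mem_insert_iff,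
      mem_singleton_iff, not_or, not_and, not_not] at hx hy
  obtain ⟨h1, h2, h3⟩ := hx
  have key : dist x u + dist u y ≤ dist x y := by
    by_cases huy : u = y
    · subst huy; simp
    · have hne : dist v u + dist u y ≠ dist v y := fun h => huy (hy h h2)
      have hlt : dist v y < dist v u + dist u y :=
        lt_of_le_of_ne (dist_triangle v u y) hne.symm
      have h4 := hT x v u y
      simp only at h4
      rw [dist_comm x v, ← h1, dist_comm u x] at h4
      rcases le_max_iff.1 h4 with h | h
      · linarith
      · rw [dist_comm v u] at h
        linarith
  have a1 := dist_triangle v u y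
  have a2 := dist_triangle x u y
  have a3 := dist_triangle u v y
  rw [dist_comm v u] at a1
  rw [abs_le]
  constructor <;> linarith

open Classical in
theorem spr_bound {T : Type*} [MetricSpace T]
    (hT : FourPoint (fun x y : T => dist x y)) (u v x y : T) :
    |dist x y - dSPR u v x y| ≤
      (sprSubtree u v ×ˢ (sprSubtree u v)ᶜ).indicator (fun _ => dist u v) (x, y) +
      ((sprSubtree u v)ᶜ ×ˢ sprSubtree u v).indicator (fun _ => dist u v) (x, y) := by
  by_cases hx : x ∈ sprSubtree u v <;> by_cases hy : y ∈ sprSubtree u v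
  · simp [dSPR, hx, hy]
  · simpa [dSPR, hx, hy] using spr_cross_bound hT u v x y hx hy
  · simpa [dSPR, hx, hy, dist_comm x y] using spr_cross_bound hT u v y x hy hx
  · simp [dSPR, hx, hy]

open MeasureTheory in
/-- The change of the `ν`-averaged distance under the subtree prune and regraft operation
at `(u,v)` is at most `2 ν(S^{T,u,v}) ν(T ∖ S^{T,u,v}) d(u,v)`. -/
theorem abs_avgDist_sub_avgDist_dSPR_le
    (T : Type*) [MetricSpace T] [CompactSpace T] [Nonempty T]
    [MeasurableSpace T] [BorelSpace T]
    (hT : IsRealTree T) (ν : MeasureTheory.Measure T) [MeasureTheory.IsProbabilityMeasure ν]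
    (u v : T) :
    |avgDist (fun x y => dist x y) ν - avgDist (dSPR u v) ν| ≤
      2 * (ν (sprSubtree u v)).toReal * (ν (sprSubtree u v)ᶜ).toReal * dist u v := by
  classical
  have h4 := hT.2.2
  have hS := measurableSet_sprSubtree' u v
  have hb := spr_bound h4 u v
  have hd : Integrable (fun p : T × T => dist p.1 p.2) (ν.prod ν) := by
    refine Integrable.of_bound (C := Metric.diam (univ : Set T)) (by fun_prop) (ae_of_all _ fun p => ?_)
    rw [Real.norm_of_nonneg dist_nonneg]
    exact dist_le_diam_of_mem isCompact_univ.isBounded (mem_univ _) (mem_univ _)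
  have i1 : Integrable ((sprSubtree u v ×ˢ (sprSubtree u v)ᶜ).indicator
      (fun _ => dist u v)) (ν.prod ν) :=
    (integrable_const _).indicator (hS.prod hS.compl)
  have i2 : Integrable (((sprSubtree u v)ᶜ ×ˢ sprSubtree u v).indicator
      (fun _ => dist u v)) (ν.prod ν) :=
    (integrable_const _).indicator (hS.compl.prod hS)
  have hm : Measurable (fun p : T × T => dSPR u v p.1 p.2) := by
    unfold dSPR
    have m1 : MeasurableSet {p : T × T | p.1 ∈ sprSubtree u v} := measurable_fst hS
    have m2 : MeasurableSet {p : T × T | p.2 ∈ sprSubtree u v} := measurable_snd hS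
    refine Measurable.ite (m1.inter m2) (by fun_prop) ?_
    refine Measurable.ite (m1.compl.inter m2.compl) (by fun_prop) ?_
    exact Measurable.ite m1 (by fun_prop) (by fun_prop)
  have hdiff : Integrable (fun p : T × T => dist p.1 p.2 - dSPR u v p.1 p.2) (ν.prod ν) := by
    refine (i1.add i2).mono' (hd.1.sub hm.aestronglyMeasurable) (ae_of_all _ fun p => ?_)
    exact hb p.1 p.2
  have hs : Integrable (fun p : T × T => dSPR u v p.1 p.2) (ν.prod ν) := by
    refine (hd.sub hdiff).congr (ae_of_all _ fun p => ?_)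
    simp [Pi.sub_apply]
  have e1 : avgDist (fun x y => dist x y) ν = ∫ p, dist p.1 p.2 ∂(ν.prod ν) :=
    (integral_prod _ hd).symm
  have e2 : avgDist (dSPR u v) ν = ∫ p, dSPR u v p.1 p.2 ∂(ν.prod ν) :=
    (integral_prod _ hs).symm
  rw [e1, e2, ← integral_sub hd hs]
  calc _ ≤ ∫ p, |dist p.1 p.2 - dSPR u v p.1 p.2| ∂(ν.prod ν) := abs_integral_le_integral_abs
    _ ≤ ∫ p, ((sprSubtree u v ×ˢ (sprSubtree u v)ᶜ).indicator (fun _ => dist u v) p +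
      ((sprSubtree u v)ᶜ ×ˢ sprSubtree u v).indicator (fun _ => dist u v) p) ∂(ν.prod ν) :=
        integral_mono hdiff.abs (i1.add i2) fun p => hb p.1 p.2
    _ = _ := by
      rw [integral_add i1 i2, integral_indicator_const _ (hS.prod hS.compl),
        integral_indicator_const _ (hS.compl.prod hS), measureReal_prod_prod, measureReal_prod_prod]
      simp only [Measure.real, smul_eq_mul]
      ring
end
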